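/- arXiv:2403.14122 — 2 statements merged into one kernel-verified Lean document; each statement's English description precedes it below -/
import Mathlib

section
/- Let p ≥ 3, let (β,h) be a p-special point with unique global maximizer m_* of H = H_{β,h,p}, and set ε := 0.24. For m in the lattice M_N := {−1, −1 + 2/N, …, 1 − 2/N, 1} define y_{m,N} := 2^{−N} √(πN(1 − m_*²)/2) · binom(N, N(1+m)/2) · exp( N(β m^p + h m) − N H(m_*) ), and let B_N := Σ_{m ∈ M_N, |m − m_*| < N^{−1/4+ε}} y_{m,N}. Let p₁(t) := exp( H^{(4)}(m_*) t⁴ / 24 ). Then B_N = (N^{3/4}/2) · (∫_{−∞}^{∞} p₁(t) dt) · (1 + O(N^{−1/2})); that is, there exist C > 0 and N₀ such that for all N ≥ N₀, | B_N − (N^{3/4}/2) ∫_{−∞}^{∞} p₁(t) dt | ≤ C N^{1/4}. -/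
open Real MeasureTheory Filter
open scoped BigOperators Topology

noncomputable section

/-- The spin value (`±1`) of a Boolean coordinate. -/
def spin (b : Bool) : ℝ := if b then 1 else -1

/-- The total magnetization `S_N = ∑ᵢ Xᵢ` of a configuration. -/
def mag {N : ℕ} (x : Fin N → Bool) : ℝ := ∑ i, spin (x i)

/-- The Hamiltonian of the `p`-spin Curie-Weiss model:
`β N^{1-p} ∑_{i₁,…,i_p} x_{i₁} ⋯ x_{i_p} + h ∑ᵢ xᵢ`. -/
def cwHamiltonian (p N : ℕ) (β h : ℝ) (x : Fin N → Bool) : ℝ :=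
  β * (N : ℝ) ^ ((1 : ℤ) - (p : ℤ)) * (∑ i : Fin p → Fin N, ∏ j, spin (x (i j)))
    + h * mag x

/-- The (unnormalized) Gibbs weight of a configuration. -/
def cwWeight (p N : ℕ) (β h : ℝ) (x : Fin N → Bool) : ℝ :=
  Real.exp (cwHamiltonian p N β h x)

/-- The probability of an event `E` under the `p`-spin Curie-Weiss measure `P_{β,h,p}`. -/
def cwProb (p N : ℕ) (β h : ℝ) (E : Set (Fin N → Bool)) : ℝ :=
  (∑ x : Fin N → Bool, E.indicator (cwWeight p N β h) x) /
    ∑ x : Fin N → Bool, cwWeight p N β h x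

/-- Conditional probability of `E` given `A` under the `p`-spin Curie-Weiss measure. -/
def cwCondProb (p N : ℕ) (β h : ℝ) (E A : Set (Fin N → Bool)) : ℝ :=
  cwProb p N β h (E ∩ A) / cwProb p N β h A

/-- The binary entropy function `I(x) = ½[(1+x)log(1+x) + (1-x)log(1-x)]`. -/
def binEnt (x : ℝ) : ℝ := (1/2) * ((1+x) * Real.log (1+x) + (1-x) * Real.log (1-x))

/-- The function `H_{β,h,p}(x) = βxᵖ + hx - I(x)`. -/
def Hfun (p : ℕ) (β h : ℝ) (x : ℝ) : ℝ := β * x ^ p + h * x - binEnt x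

/-- `m` is a global maximizer of `H_{β,h,p}` on `[-1,1]`, lying in `(-1,1)`. -/
def isMaximizer (p : ℕ) (β h m : ℝ) : Prop :=
  m ∈ Set.Ioo (-1 : ℝ) 1 ∧ ∀ x ∈ Set.Icc (-1 : ℝ) 1, Hfun p β h x ≤ Hfun p β h m

/-- `m` is the unique global maximizer of `H_{β,h,p}`. -/
def isUniqueMaximizer (p : ℕ) (β h m : ℝ) : Prop :=
  isMaximizer p β h m ∧ ∀ m', isMaximizer p β h m' → m' = m

/-- `(β,h)` is a `p`-regular point with unique global maximizer `m`. -/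
def pRegular (p : ℕ) (β h m : ℝ) : Prop :=
  isUniqueMaximizer p β h m ∧ iteratedDeriv 2 (Hfun p β h) m < 0

/-- `(β,h)` is a `p`-special point with unique global maximizer `m`. -/
def pSpecial (p : ℕ) (β h m : ℝ) : Prop :=
  isUniqueMaximizer p β h m ∧ iteratedDeriv 2 (Hfun p β h) m = 0

/-- `(β,h)` is a `p`-critical point: `H_{β,h,p}` has more than one global maximizer. -/
def pCritical (p : ℕ) (β h : ℝ) : Prop :=
  ∃ m₁ m₂, m₁ ≠ m₂ ∧ isMaximizer p β h m₁ ∧ isMaximizer p β h m₂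

/-- The probability assigned to a set `S ⊆ ℝ` by the centered Gaussian with variance `v`. -/
def gaussProb (v : ℝ) (S : Set ℝ) : ℝ :=
  ∫ t in S, (Real.sqrt (2 * Real.pi * v))⁻¹ * Real.exp (-t ^ 2 / (2 * v))

/-- The CDF of the centered Gaussian with variance `v`. -/
def gaussCDF (v x : ℝ) : ℝ := gaussProb v (Set.Iic x)

/-- The standard normal CDF `Φ`. -/
def stdNormCDF (x : ℝ) : ℝ := gaussCDF 1 x

/-- The CDF of the limit law `F` at a `p`-special point, where `c = H⁽⁴⁾(m_*)`:
`dF(x) = (2/Γ(1/4)) (-c/24)^{1/4} exp(c x⁴/24) dx`. -/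
def specialCDF (c x : ℝ) : ℝ :=
  ∫ t in Set.Iic x, (2 / Real.Gamma (1/4)) * ((-c) / 24) ^ ((1:ℝ)/4) * Real.exp (c * t ^ 4 / 24)

/-- The inverse hyperbolic tangent `tanh⁻¹(t) = ½ log((1+t)/(1-t))`. -/
def arctanh (t : ℝ) : ℝ := (1/2) * Real.log ((1+t)/(1-t))

/-- The function `g(t) = tanh⁻¹(t)/(p t^{p-1})`, so that the maximum pseudolikelihood
estimate of `β` is `g(X̄)`. -/
def gMPL (p : ℕ) (t : ℝ) : ℝ := arctanh t / (p * t ^ (p - 1))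

/-- The threshold `β*(p) = inf{β ≥ 0 : sup_{x∈[0,1]} H_{β,0,p}(x) > 0}`. -/
def betaStar (p : ℕ) : ℝ := sInf {b : ℝ | 0 ≤ b ∧ ∃ x ∈ Set.Icc (0:ℝ) 1, 0 < Hfun p b 0 x}

/-- The term `y_{m,N}` for `m = -1 + 2k/N` in the lattice `M_N`:
`y_{m,N} = 2^{-N} √(πN(1-m_*²)/2) · C(N, N(1+m)/2) · exp(N(βmᵖ + hm) - N H(m_*))`. -/
def yTerm (p : ℕ) (β h mstar : ℝ) (N k : ℕ) : ℝ :=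
  (2 : ℝ) ^ (-(N : ℤ)) * Real.sqrt (Real.pi * N * (1 - mstar ^ 2) / 2) *
    (N.choose k) *
    Real.exp (N * (β * (-1 + 2 * (k : ℝ) / N) ^ p + h * (-1 + 2 * (k : ℝ) / N))
      - N * Hfun p β h mstar)

/-- `B_N`: the sum of `y_{m,N}` over lattice points `m ∈ M_N` with
`|m - m_*| < N^{-1/4+ε}`, `ε = 0.24`. -/
def BNsum (p : ℕ) (β h mstar : ℝ) (N : ℕ) : ℝ :=
  ∑ k ∈ Finset.range (N + 1),
    Set.indicator
      {k : ℕ | |(-1 + 2 * (k : ℝ) / N) - mstar| < (N : ℝ) ^ (-(1:ℝ)/4 + (0.24 : ℝ))}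
      (yTerm p β h mstar N) k

/-- The integral over `ℝ` is the sum of the integrals over the cells of a lattice of step `s`. -/
theorem hasSum_integral_lattice_cells {f : ℝ → ℝ} (hf : Integrable f) {s : ℝ} (hs : 0 < s)
    (θ : ℝ) :
    HasSum (fun k : ℤ => ∫ x in (θ + k * s)..(θ + k * s + s), f x) (∫ x, f x) := by
  have h := hasSum_integral_iUnion (μ := volume) (f := f)
    (s := fun k : ℤ => Set.Ioc (θ + k • s) (θ + (k + 1) • s))
    (fun _ => measurableSet_Ioc) (Set.pairwise_disjoint_Ioc_add_zsmul θ s) hf.integrableOn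
  rw [iUnion_Ioc_add_zsmul hs, setIntegral_univ] at h
  refine h.congr_fun fun k => ?_
  have e1 : θ + k * s = θ + k • s := by rw [zsmul_eq_mul]
  have e2 : θ + k * s + s = θ + (k + 1) • s := by rw [zsmul_eq_mul]; push_cast; ring
  rw [intervalIntegral.integral_of_le (by linarith), e2, e1]

/-- One cell of the left Riemann sum differs from the integral by at most the step times the
variation. -/
theorem abs_cell_sub_integral_le {F F' : ℝ → ℝ} (hF : ∀ x, HasDerivAt F (F' x) x)
    (hF' : Continuous F') {s : ℝ} (hs : 0 < s) (t : ℝ) :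
    |s * F t - ∫ x in t..(t + s), F x| ≤ s * ∫ x in t..(t + s), |F' x| := by
  have hFc : Continuous F := continuous_iff_continuousAt.2 fun x => (hF x).continuousAt
  have h1 : s * F t - ∫ x in t..(t + s), F x = ∫ x in t..(t + s), (F t - F x) := by
    rw [intervalIntegral.integral_sub (by simp) (hFc.intervalIntegrable _ _)]
    simp
  rw [h1]
  have h2 := intervalIntegral.norm_integral_le_of_norm_le_const (a := t) (b := t + s)
    (f := fun x => F t - F x) (C := ∫ x in t..(t + s), |F' x|) ?_
  · simpa [abs_of_pos hs, mul_comm] using h2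
  intro x hx
  rw [Set.uIoc_of_le (by linarith)] at hx
  have h3 : F x - F t = ∫ y in t..x, F' y :=
    (intervalIntegral.integral_eq_sub_of_hasDerivAt (fun y _ => hF y)
      (hF'.intervalIntegrable _ _)).symm
  rw [norm_sub_rev, h3]
  refine (intervalIntegral.norm_integral_le_integral_norm hx.1.le).trans ?_
  exact intervalIntegral.integral_mono_interval le_rfl hx.1.le hx.2
    (Filter.Eventually.of_forall fun _ => norm_nonneg _) (hF'.norm.intervalIntegrable _ _)

/-- A lattice sum of step `s` approximates the integral with error `s` times the total
variation. -/
theorem lattice_sum_sub_integral {F F' : ℝ → ℝ} (hF : ∀ x, HasDerivAt F (F' x) x)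
    (hF' : Continuous F') (hFi : Integrable F) (hFi' : Integrable F') {s : ℝ} (hs : 0 < s)
    (θ : ℝ) :
    Summable (fun k : ℤ => F (θ + k * s)) ∧
      |s * (∑' k : ℤ, F (θ + k * s)) - ∫ x, F x| ≤ s * ∫ x, |F' x| := by
  have hI := hasSum_integral_lattice_cells hFi hs θ
  have hV := (hasSum_integral_lattice_cells hFi'.abs hs θ).mul_left s
  have hcell := fun k : ℤ => abs_cell_sub_integral_le hF hF' hs (θ + k * s)
  have hd : Summable fun k : ℤ =>
      s * F (θ + k * s) - ∫ x in (θ + k * s)..(θ + k * s + s), F x :=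
    Summable.of_norm_bounded hV.summable hcell
  have hsum : Summable fun k : ℤ => s * F (θ + k * s) := by
    simpa using hd.add hI.summable
  refine ⟨(summable_mul_left_iff hs.ne').1 hsum, ?_⟩
  rw [← tsum_mul_left, ← hI.tsum_eq, ← hsum.tsum_sub hI.summable]
  rw [← Real.norm_eq_abs]
  exact tsum_of_norm_bounded hV hcell

/-- Quantitative Stirling formula: `log (stirlingSeq n)` is within `1 / (12 n)` of its limit. -/
theorem log_stirlingSeq_sub_le {n : ℕ} (hn : n ≠ 0) :
    |log (Stirling.stirlingSeq n) - log √π| ≤ 1 / n := by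
  have hpos : 0 < √π := by positivity
  have hlow : log √π ≤ log (Stirling.stirlingSeq n) :=
    log_le_log hpos (Stirling.sqrt_pi_le_stirlingSeq hn)
  rw [abs_of_nonneg (by linarith)]
  have key : ∀ j : ℕ, log (Stirling.stirlingSeq n) - log (Stirling.stirlingSeq (n + j))
      ≤ 1 / n - 1 / (n + j : ℕ) := by
    intro j
    induction j with
    | zero => simp
    | succ j ih =>
      have h := Stirling.log_stirlingSeq_sdiff_le (n + j)
      have hnj : (0 : ℝ) < (n + j : ℕ) := by
        exact_mod_cast Nat.add_pos_left (Nat.pos_of_ne_zero hn) j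
      have h2 : 1 / (12 * ((n + j : ℕ) : ℝ) * ((n + j : ℕ) + 1))
          ≤ 1 / ((n + j : ℕ) : ℝ) - 1 / ((n + j : ℕ) + 1) := by
        rw [div_sub_div _ _ (by positivity) (by positivity),
          div_le_div_iff₀ (by positivity) (by positivity)]
        nlinarith [mul_pos hnj (by linarith : (0 : ℝ) < (n + j : ℕ) + 1)]
      have h3 : ((n + (j + 1) : ℕ) : ℝ) = (n + j : ℕ) + 1 := by push_cast; ring
      rw [h3, ← add_assoc]
      linarith
  have hlim : Tendsto (fun j : ℕ => log (Stirling.stirlingSeq n)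
      - log (Stirling.stirlingSeq (n + j))) atTop (𝓝 (log (Stirling.stirlingSeq n) - log √π)) := by
    refine tendsto_const_nhds.sub ?_
    refine Tendsto.log ?_ hpos.ne'
    have := Stirling.tendsto_stirlingSeq_sqrt_pi.comp (tendsto_add_atTop_nat n)
    refine this.congr fun j => ?_
    simp [add_comm]
  refine le_of_tendsto' hlim fun j => (key j).trans ?_
  have : (0 : ℝ) ≤ 1 / (n + j : ℕ) := by positivity
  linarith

/-- The lattice point `x = -1 + 2k/N` splits `N` into `k = N(1+x)/2` and `N - k = N(1-x)/2`, and
the logarithm of the binomial coefficient is governed by the binary entropy of `x`. -/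
theorem log_choose_eq {N k : ℕ} (hk : 0 < k) (hkN : k < N) {x : ℝ}
    (hx : x = -1 + 2 * (k : ℝ) / N) :
    log (N.choose k) = N * log 2 - N * binEnt x + log (Stirling.stirlingSeq N)
      - log (Stirling.stirlingSeq k) - log (Stirling.stirlingSeq (N - k))
      + 1 / 2 * (log 2 - log N - log (1 - x ^ 2)) := by
  have hN0 : (0 : ℝ) < N := by exact_mod_cast hk.trans hkN
  have hk0 : (0 : ℝ) < k := by exact_mod_cast hk
  have hkN' : (k : ℝ) < N := by exact_mod_cast hkN
  have hsub : ((N - k : ℕ) : ℝ) = N - k := Nat.cast_sub hkN.le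
  have hk1 : (k : ℝ) = N * (1 + x) / 2 := by rw [hx]; field_simp; ring
  have hk2 : (N : ℝ) - k = N * (1 - x) / 2 := by rw [hx]; field_simp; ring
  have h1 : 0 < 1 + x := by
    by_contra hc; push Not at hc; nlinarith
  have h2 : 0 < 1 - x := by
    by_contra hc; push Not at hc; nlinarith
  have hfac : log (N.choose k) = log N.factorial - log k.factorial - log (N - k).factorial := by
    rw [Nat.cast_choose ℝ hkN.le, log_div (by positivity) (by positivity),
      log_mul (by positivity) (by positivity)]
    ring
  have lk : log (k : ℝ) = log N + log (1 + x) - log 2 := by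
    rw [hk1, log_div (by positivity) (by norm_num), log_mul hN0.ne' h1.ne']
  have lk' : log ((N : ℝ) - k) = log N + log (1 - x) - log 2 := by
    rw [hk2, log_div (by positivity) (by norm_num), log_mul hN0.ne' h2.ne']
  have lx : log (1 - x ^ 2) = log (1 + x) + log (1 - x) := by
    rw [← log_mul h1.ne' h2.ne']; congr 1; ring
  have hNk0 : (0 : ℝ) < N - k := by linarith
  have e1 := Stirling.log_stirlingSeq_formula N
  have e2 := Stirling.log_stirlingSeq_formula k
  have e3 := Stirling.log_stirlingSeq_formula (N - k)
  rw [log_mul (by norm_num) hN0.ne', log_div hN0.ne' (exp_pos 1).ne', log_exp] at e1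
  rw [log_mul (by norm_num) hk0.ne', log_div hk0.ne' (exp_pos 1).ne', log_exp, lk] at e2
  rw [hsub, log_mul (by norm_num) hNk0.ne', log_div hNk0.ne' (exp_pos 1).ne', log_exp, lk',
    hk2] at e3
  rw [hfac, e1, e2, e3, lx, binEnt]
  have e4 : (k : ℝ) * (log N + log (1 + x) - log 2 - 1)
      = N * (1 + x) / 2 * (log N + log (1 + x) - log 2 - 1) := by rw [← hk1]
  rw [e4]
  ring

theorem analyticAt_binEnt {x : ℝ} (hx : x ∈ Set.Ioo (-1 : ℝ) 1) : AnalyticAt ℝ binEnt x := by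
  have h1 : 0 < 1 + x := by linarith [hx.1]
  have h2 : 0 < 1 - x := by linarith [hx.2]
  have a1 : AnalyticAt ℝ (fun y : ℝ => 1 + y) x := by fun_prop
  have a2 : AnalyticAt ℝ (fun y : ℝ => 1 - y) x := by fun_prop
  exact analyticAt_const.mul ((a1.mul (a1.log h1)).add (a2.mul (a2.log h2)))

theorem analyticAt_Hfun (p : ℕ) (β h : ℝ) {x : ℝ} (hx : x ∈ Set.Ioo (-1 : ℝ) 1) :
    AnalyticAt ℝ (Hfun p β h) x := by
  have a1 : AnalyticAt ℝ (fun y : ℝ => β * y ^ p + h * y) x := by fun_prop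
  exact a1.sub (analyticAt_binEnt hx)

/-- If the `n`-th derivative agrees with `g` on an open set and `g` has derivative `d` there,
then `d` is the next derivative. -/
theorem iteratedDeriv_succ_eq_of_eqOn {f g : ℝ → ℝ} {U : Set ℝ} (hU : IsOpen U) {n : ℕ}
    (hfg : Set.EqOn (iteratedDeriv n f) g U) {x d : ℝ} (hx : x ∈ U) (hg : HasDerivAt g d x) :
    iteratedDeriv (n + 1) f x = d := by
  rw [iteratedDeriv_succ, (hfg.eventuallyEq_of_mem (hU.mem_nhds hx)).deriv_eq, hg.deriv]

theorem iteratedDeriv_two_three_four_Hfun (q : ℕ) (β h : ℝ) {x : ℝ}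
    (hx : x ∈ Set.Ioo (-1 : ℝ) 1) :
    iteratedDeriv 2 (Hfun (q + 3) β h) x =
        β * (q + 3) * (q + 2) * x ^ (q + 1) - 1 / 2 * (1 / (1 + x) + 1 / (1 - x)) ∧
      iteratedDeriv 3 (Hfun (q + 3) β h) x =
        β * (q + 3) * (q + 2) * (q + 1) * x ^ q
          - 1 / 2 * (-1 / (1 + x) ^ 2 + 1 / (1 - x) ^ 2) ∧
      iteratedDeriv 4 (Hfun (q + 3) β h) x =
        β * (q + 3) * (q + 2) * (q + 1) * (q * x ^ (q - 1))
          - (1 / (1 + x) ^ 3 + 1 / (1 - x) ^ 3) := by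
  have hp1 : ∀ y ∈ Set.Ioo (-1 : ℝ) 1, 1 + y ≠ 0 := fun y hy => by linarith [hy.1]
  have hp2 : ∀ y ∈ Set.Ioo (-1 : ℝ) 1, 1 - y ≠ 0 := fun y hy => by linarith [hy.2]
  have da : ∀ y : ℝ, HasDerivAt (fun z : ℝ => 1 + z) 1 y := fun y =>
    (hasDerivAt_id y).const_add 1
  have db : ∀ y : ℝ, HasDerivAt (fun z : ℝ => 1 - z) (-1) y := fun y =>
    (hasDerivAt_id y).const_sub 1
  have d0 : Set.EqOn (iteratedDeriv 0 (Hfun (q + 3) β h)) (Hfun (q + 3) β h)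
      (Set.Ioo (-1) 1) := fun y _ => by rw [iteratedDeriv_zero]
  have d1 : Set.EqOn (iteratedDeriv 1 (Hfun (q + 3) β h))
      (fun y => β * ((q + 3) * y ^ (q + 2)) + h - 1 / 2 * (log (1 + y) - log (1 - y)))
      (Set.Ioo (-1) 1) := fun y hy => by
    refine iteratedDeriv_succ_eq_of_eqOn isOpen_Ioo d0 hy ?_
    have := ((((hasDerivAt_pow (q + 3) y).const_mul β).add
      ((hasDerivAt_id y).const_mul h))).sub
      ((((da y).mul ((da y).log (hp1 y hy))).add
        ((db y).mul ((db y).log (hp2 y hy)))).const_mul (1 / 2))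
    refine this.congr_deriv ?_
    have := hp1 y hy
    have := hp2 y hy
    push_cast
    field_simp
    simp
    ring
  have d2 : Set.EqOn (iteratedDeriv 2 (Hfun (q + 3) β h))
      (fun y => β * (q + 3) * (q + 2) * y ^ (q + 1) - 1 / 2 * (1 / (1 + y) + 1 / (1 - y)))
      (Set.Ioo (-1) 1) := fun y hy => by
    refine iteratedDeriv_succ_eq_of_eqOn isOpen_Ioo d1 hy ?_
    have := (((((hasDerivAt_pow (q + 2) y).const_mul ((q : ℝ) + 3)).const_mul β).add_const h)).sub
      ((((da y).log (hp1 y hy)).sub ((db y).log (hp2 y hy))).const_mul (1 / 2))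
    refine this.congr_deriv ?_
    have := hp1 y hy
    have := hp2 y hy
    push_cast
    simp
    ring
  have d3 : Set.EqOn (iteratedDeriv 3 (Hfun (q + 3) β h))
      (fun y => β * (q + 3) * (q + 2) * (q + 1) * y ^ q
        - 1 / 2 * (-1 / (1 + y) ^ 2 + 1 / (1 - y) ^ 2))
      (Set.Ioo (-1) 1) := fun y hy => by
    refine iteratedDeriv_succ_eq_of_eqOn isOpen_Ioo d2 hy ?_
    have := ((hasDerivAt_pow (q + 1) y).const_mul (β * (q + 3) * (q + 2))).sub
      ((((hasDerivAt_const y (1 : ℝ)).div (da y) (hp1 y hy)).add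
        ((hasDerivAt_const y (1 : ℝ)).div (db y) (hp2 y hy))).const_mul (1 / 2))
    refine this.congr_deriv ?_
    push_cast
    simp
    ring
  refine ⟨d2 hx, d3 hx, ?_⟩
  refine iteratedDeriv_succ_eq_of_eqOn isOpen_Ioo d3 hx ?_
  have := ((hasDerivAt_pow q x).const_mul (β * (q + 3) * (q + 2) * (q + 1))).sub
    ((((hasDerivAt_const x (-1 : ℝ)).div ((da x).pow 2) (pow_ne_zero 2 (hp1 x hx))).add
      ((hasDerivAt_const x (1 : ℝ)).div ((db x).pow 2)
        (pow_ne_zero 2 (hp2 x hx)))).const_mul (1 / 2))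
  refine this.congr_deriv ?_
  have := hp1 x hx
  have := hp2 x hx
  simp
  field_simp

/-- Taylor expansion with remainder for a function analytic at `x`. -/
theorem AnalyticAt.taylor_bound {f : ℝ → ℝ} {x : ℝ} (hf : AnalyticAt ℝ f x) (n : ℕ) :
    ∃ C > 0, ∃ r > 0, ∀ u, |u| ≤ r →
      |f (x + u) - ∑ k ∈ Finset.range n, iteratedDeriv k f x / k.factorial * u ^ k|
        ≤ C * |u| ^ n := by
  obtain ⟨C, hC, hb⟩ := (hf.hasFPowerSeriesAt.isBigO_sub_partialSum_pow n).exists_pos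
  rw [Asymptotics.isBigOWith_iff] at hb
  obtain ⟨r, hr, hb⟩ := Metric.eventually_nhds_iff.1 hb
  refine ⟨C, hC, r / 2, by positivity, fun u hu => ?_⟩
  have h := hb (y := u) (by rw [dist_zero_right, Real.norm_eq_abs]; linarith)
  simpa [FormalMultilinearSeries.partialSum, FormalMultilinearSeries.ofScalars_apply_eq,
    mul_comm] using h

/-- At an interior maximum with vanishing second derivative, the third one vanishes too. -/
theorem AnalyticAt.iteratedDeriv_three_eq_zero {f : ℝ → ℝ} {x : ℝ} (hf : AnalyticAt ℝ f x)
    (hmax : IsLocalMax f x) (h2 : iteratedDeriv 2 f x = 0) : iteratedDeriv 3 f x = 0 := by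
  obtain ⟨C, hC, r, hr, hb⟩ := hf.taylor_bound 4
  have h1 : iteratedDeriv 1 f x = 0 := by rw [iteratedDeriv_one, hmax.deriv_eq_zero]
  simp only [Finset.sum_range_succ, Finset.sum_range_zero, h1, h2, iteratedDeriv_zero] at hb
  norm_num [Nat.factorial] at hb
  obtain ⟨r', hr', hm⟩ := Metric.eventually_nhds_iff.1 hmax
  set d := iteratedDeriv 3 f x
  by_contra hd
  have hdpos : 0 < |d| := abs_pos.2 hd
  set ρ := min (min r (r' / 2)) (|d| / (12 * C)) with hρ
  have hρ0 : 0 < ρ := by positivity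
  have hρ1 : ρ ≤ r := (min_le_left _ _).trans (min_le_left _ _)
  have hρ2 : ρ ≤ r' / 2 := (min_le_left _ _).trans (min_le_right _ _)
  have hρ3 : C * ρ ≤ |d| / 12 := by
    have : ρ ≤ |d| / (12 * C) := min_le_right _ _
    rw [le_div_iff₀ (by positivity)] at this
    linarith
  have main : ∀ u, |u| = ρ → d / 6 * u ^ 3 ≤ |d| / 12 * ρ ^ 3 := by
    intro u hu
    have e1 := abs_le.1 (hb u (hu ▸ hρ1))
    have e2 : f (x + u) ≤ f x := hm (by simp [hu]; linarith)
    have e3 : C * |u| ^ 4 ≤ |d| / 12 * ρ ^ 3 := by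
      rw [hu, show C * ρ ^ 4 = C * ρ * ρ ^ 3 by ring]
      gcongr
    have e4 : C * u ^ 4 = C * |u| ^ 4 := by rw [pow_abs, abs_of_nonneg (by positivity)]
    linarith [e1.1, e1.2]
  have m1 := main ρ (abs_of_pos hρ0)
  have m2 := main (-ρ) (by rw [abs_neg, abs_of_pos hρ0])
  have h3 : 0 < ρ ^ 3 := by positivity
  rcases abs_cases d with ⟨e, _⟩ | ⟨e, _⟩ <;> rw [e] at m1 m2 hdpos <;>
    nlinarith [mul_pos hdpos h3]

/-- At a `p`-special point the derivatives of `H` of orders one to three vanish and the fourth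
one is negative. -/
theorem pSpecial.derivatives {p : ℕ} (hp : 3 ≤ p) {β h m : ℝ} (hsp : pSpecial p β h m) :
    iteratedDeriv 1 (Hfun p β h) m = 0 ∧ iteratedDeriv 2 (Hfun p β h) m = 0 ∧
      iteratedDeriv 3 (Hfun p β h) m = 0 ∧ iteratedDeriv 4 (Hfun p β h) m < 0 := by
  obtain ⟨⟨⟨hm, hmax⟩, -⟩, h2⟩ := hsp
  have hloc : IsLocalMax (Hfun p β h) m :=
    Filter.mem_of_superset (isOpen_Ioo.mem_nhds hm) fun x hx =>
      hmax x (Set.Ioo_subset_Icc_self hx)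
  have h3 := (analyticAt_Hfun p β h hm).iteratedDeriv_three_eq_zero hloc h2
  refine ⟨by rw [iteratedDeriv_one, hloc.deriv_eq_zero], h2, h3, ?_⟩
  obtain ⟨q, rfl⟩ := Nat.exists_eq_add_of_le' hp
  obtain ⟨f2, f3, f4⟩ := iteratedDeriv_two_three_four_Hfun q β h hm
  rw [f2] at h2
  rw [f3] at h3
  rw [f4]
  have p1 : 0 < 1 + m := by linarith [hm.1]
  have p2 : 0 < 1 - m := by linarith [hm.2]
  have hm0 : m ≠ 0 := by
    rintro rfl
    simp at h2
  have hqm : (q : ℝ) * m ^ (q - 1) * m = q * m ^ q := by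
    rcases q with _ | q
    · simp
    · rw [Nat.add_sub_cancel, mul_assoc, ← pow_succ]
  set A := β * (q + 3) * (q + 2) * m ^ q with hA
  have hAm : A * m * ((1 + m) * (1 - m)) = 1 := by
    have : A * m = 1 / 2 * (1 / (1 + m) + 1 / (1 - m)) := by
      rw [hA]; rw [pow_succ] at h2; linarith
    rw [this]; field_simp; ring
  have hA3 : A * (q + 1) * ((1 + m) * (1 - m)) ^ 2 = 2 * m := by
    have : A * (q + 1) = 1 / 2 * (-1 / (1 + m) ^ 2 + 1 / (1 - m) ^ 2) := by
      rw [hA]; linarith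
    rw [this]; field_simp; ring
  have hw : (0 : ℝ) < (1 + m) * (1 - m) := mul_pos p1 p2
  have hm2 : (q + 1) * ((1 + m) * (1 - m)) = 2 * m ^ 2 := by
    have e : m * (A * (q + 1) * ((1 + m) * (1 - m)) ^ 2)
      = (A * m * ((1 + m) * (1 - m))) * ((q + 1) * ((1 + m) * (1 - m))) := by ring
    rw [hA3, hAm] at e
    linarith
  have hB : β * (q + 3) * (q + 2) * (q + 1) * (q * m ^ (q - 1)) * m ^ 2
      * ((1 + m) * (1 - m)) = (q + 1) * q := by
    have e : β * (q + 3) * (q + 2) * (q + 1) * (q * m ^ (q - 1)) * m ^ 2 * ((1 + m) * (1 - m))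
      = β * (q + 3) * (q + 2) * (q + 1) * (q * m ^ (q - 1) * m) * m * ((1 + m) * (1 - m)) := by
      ring
    rw [e, hqm]
    linear_combination ((q : ℝ) + 1) * q * hAm
  set B := β * (q + 3) * (q + 2) * (q + 1) * (q * m ^ (q - 1))
  have hm2pos : 0 < m ^ 2 := by positivity
  have hB2 : B * ((1 + m) * (1 - m)) ^ 2 = 2 * q := by
    refine mul_left_cancel₀ hm2pos.ne' ?_
    linear_combination ((1 + m) * (1 - m)) * hB + q * hm2
  have e3 : (B - (1 / (1 + m) ^ 3 + 1 / (1 - m) ^ 3)) * ((1 + m) * (1 - m)) ^ 3 = -4 := by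
    have e : (1 / (1 + m) ^ 3 + 1 / (1 - m) ^ 3) * ((1 + m) * (1 - m)) ^ 3
      = (1 + m) ^ 3 + (1 - m) ^ 3 := by field_simp; ring
    rw [sub_mul, e]
    linear_combination ((1 + m) * (1 - m)) * hB2 + 2 * hm2
  by_contra hc
  push Not at hc
  have := mul_nonneg hc (pow_pos hw 3).le
  linarith

theorem exists_pow_mul_exp_neg_quartic_le (n : ℕ) {b : ℝ} (hb : 0 < b) :
    ∃ C > 0, ∀ t : ℝ, (1 + |t|) ^ n * exp (-(b * t ^ 4)) ≤ C * (1 + t ^ 2)⁻¹ := by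
  refine ⟨(n + 2).factorial * (8 / b) ^ (n + 2) * exp b, by positivity, fun t => ?_⟩
  rw [← div_eq_mul_inv, le_div_iff₀ (by positivity), exp_neg, ← div_eq_mul_inv, div_mul_eq_mul_div,
    div_le_iff₀ (exp_pos _)]
  have h0 : 0 ≤ |t| := abs_nonneg t
  have h1 : 1 + t ^ 2 ≤ (1 + |t|) ^ 2 := by rw [← sq_abs t]; nlinarith
  have h2 : (1 + |t|) ^ 4 ≤ 8 * (1 + t ^ 4) := by
    have e : t ^ 4 = |t| ^ 4 := by rw [pow_abs, abs_of_nonneg (by positivity)]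
    rw [e]
    nlinarith [sq_nonneg (|t| ^ 2 - 1), sq_nonneg (|t| - 1), sq_nonneg (|t| + 1),
      mul_nonneg (sq_nonneg (|t| - 1)) (sq_nonneg (|t| + 1)), sq_nonneg (|t| ^ 2 - |t|)]
  have h3 := pow_div_factorial_le_exp (x := b / 8 * (1 + |t|) ^ 4) (by positivity) (n + 2)
  rw [div_le_iff₀ (by positivity)] at h3
  have h4 : exp (b / 8 * (1 + |t|) ^ 4) ≤ exp b * exp (b * t ^ 4) := by
    rw [← exp_add]
    refine exp_le_exp.2 ?_
    nlinarith
  calc (1 + |t|) ^ n * (1 + t ^ 2) ≤ (1 + |t|) ^ n * (1 + |t|) ^ 2 := by gcongr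
    _ = (1 + |t|) ^ (n + 2) := by ring
    _ ≤ ((1 + |t|) ^ 4) ^ (n + 2) := by
        gcongr
        exact le_self_pow₀ (by linarith) (by norm_num)
    _ = (8 / b) ^ (n + 2) * (b / 8 * (1 + |t|) ^ 4) ^ (n + 2) := by
        rw [← mul_pow]; congr 1; field_simp
    _ ≤ (8 / b) ^ (n + 2) * (exp b * exp (b * t ^ 4) * (n + 2).factorial) := by
        gcongr
        exact h3.trans (by gcongr)
    _ = _ := by ring

theorem integrable_of_abs_le_pow_mul_exp {F : ℝ → ℝ} (hF : Continuous F) {n : ℕ} {M b : ℝ}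
    (hb : 0 < b) (h : ∀ t, |F t| ≤ M * (1 + |t|) ^ n * exp (-(b * t ^ 4))) : Integrable F := by
  obtain ⟨C, -, hC⟩ := exists_pow_mul_exp_neg_quartic_le n hb
  have hM : 0 ≤ M := by
    have := (abs_nonneg _).trans (h 0)
    simpa using this
  refine (integrable_inv_one_add_sq.const_mul (M * C)).mono' hF.aestronglyMeasurable
    (Filter.Eventually.of_forall fun t => (h t).trans ?_)
  rw [mul_assoc, mul_assoc]
  exact mul_le_mul_of_nonneg_left (hC t) hM

/-- Lattice sums of an integrable function with integrable derivative equal the integral divided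
by the step, up to a bounded error. -/
theorem exists_lattice_sum_error {F F' : ℝ → ℝ} (hF : ∀ x, HasDerivAt F (F' x) x)
    (hF' : Continuous F') (hFi : Integrable F) (hFi' : Integrable F') :
    ∃ V ≥ 0, ∀ s > 0, ∀ θ : ℝ, Summable (fun k : ℤ => F (θ + k * s)) ∧
      |(∑' k : ℤ, F (θ + k * s)) - (∫ x, F x) / s| ≤ V := by
  refine ⟨∫ x, |F' x|, integral_nonneg fun _ => abs_nonneg _, fun s hs θ => ?_⟩
  obtain ⟨h1, h2⟩ := lattice_sum_sub_integral hF hF' hFi hFi' hs θ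
  refine ⟨h1, le_of_mul_le_mul_left ?_ hs⟩
  rwa [← abs_of_pos hs, ← abs_mul, abs_of_pos hs, mul_sub, mul_div_cancel₀ _ hs.ne']

theorem exists_lattice_sum_error_inv_one_add_sq :
    ∃ V ≥ 0, ∀ s > 0, ∀ θ : ℝ, Summable (fun k : ℤ => (1 + (θ + k * s) ^ 2)⁻¹) ∧
      |(∑' k : ℤ, (1 + (θ + k * s) ^ 2)⁻¹) - π / s| ≤ V := by
  have hpos : ∀ t : ℝ, 1 + t ^ 2 ≠ 0 := fun t => by positivity
  have hd : ∀ t : ℝ, HasDerivAt (fun t : ℝ => (1 + t ^ 2)⁻¹) (-(2 * t) / (1 + t ^ 2) ^ 2) t :=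
    fun t => by simpa using ((hasDerivAt_pow 2 t).const_add 1).fun_inv (hpos t)
  have hc : Continuous fun t : ℝ => -(2 * t) / (1 + t ^ 2) ^ 2 :=
    by fun_prop (disch := intro t; exact pow_ne_zero 2 (hpos t))
  have hi : Integrable fun t : ℝ => -(2 * t) / (1 + t ^ 2) ^ 2 := by
    refine integrable_inv_one_add_sq.mono' hc.aestronglyMeasurable
      (Filter.Eventually.of_forall fun t => ?_)
    rw [Real.norm_eq_abs, abs_div, abs_neg, abs_of_pos (by positivity : 0 < (1 + t ^ 2) ^ 2),
      inv_eq_one_div, div_le_div_iff₀ (by positivity) (by positivity), one_mul, sq (1 + t ^ 2)]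
    gcongr
    rw [abs_mul, abs_two, ← sq_abs t]
    nlinarith [sq_nonneg (|t| - 1)]
  simpa [integral_univ_inv_one_add_sq] using
    exists_lattice_sum_error hd hc integrable_inv_one_add_sq hi

theorem exists_lattice_sum_error_exp_quartic {a : ℝ} (ha : 0 < a) :
    ∃ V ≥ 0, ∀ s > 0, ∀ θ : ℝ, Summable (fun k : ℤ => exp (-(a * (θ + k * s) ^ 4))) ∧
      |(∑' k : ℤ, exp (-(a * (θ + k * s) ^ 4))) - (∫ t, exp (-(a * t ^ 4))) / s| ≤ V := by
  have hd : ∀ t : ℝ, HasDerivAt (fun t : ℝ => exp (-(a * t ^ 4)))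
      (exp (-(a * t ^ 4)) * -(a * (4 * t ^ 3))) t :=
    fun t => by simpa using (((hasDerivAt_pow 4 t).const_mul a).fun_neg).exp
  refine exists_lattice_sum_error hd (by fun_prop) ?_ ?_
  · exact integrable_of_abs_le_pow_mul_exp (n := 0) (M := 1) (by fun_prop) ha fun t => by simp
  · refine integrable_of_abs_le_pow_mul_exp (n := 3) (M := 4 * a) (by fun_prop) ha fun t => ?_
    rw [abs_mul, abs_of_pos (exp_pos _), mul_comm, abs_neg, abs_mul, abs_mul, abs_pow,
      abs_of_pos ha, abs_of_pos (by norm_num : (0 : ℝ) < 4)]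
    have : |t| ^ 3 ≤ (1 + |t|) ^ 3 := by gcongr; linarith
    rw [show a * (4 * |t| ^ 3) = 4 * a * |t| ^ 3 by ring]
    gcongr

/-- The odd function `(c t⁵ + l t) exp (-a t⁴)` has bounded lattice sums. -/
theorem exists_lattice_sum_bound_odd {a : ℝ} (ha : 0 < a) (c l : ℝ) :
    ∃ V ≥ 0, ∀ s > 0, ∀ θ : ℝ,
      Summable (fun k : ℤ => (c * (θ + k * s) ^ 5 + l * (θ + k * s)) *
        exp (-(a * (θ + k * s) ^ 4))) ∧
      |∑' k : ℤ, (c * (θ + k * s) ^ 5 + l * (θ + k * s)) * exp (-(a * (θ + k * s) ^ 4))|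
        ≤ V := by
  have hd : ∀ t : ℝ, HasDerivAt (fun t : ℝ => (c * t ^ 5 + l * t) * exp (-(a * t ^ 4)))
      ((c * (5 * t ^ 4) + l) * exp (-(a * t ^ 4)) +
        (c * t ^ 5 + l * t) * (exp (-(a * t ^ 4)) * -(a * (4 * t ^ 3)))) t := fun t => by
    have h1 := ((hasDerivAt_pow 5 t).const_mul c).fun_add ((hasDerivAt_id t).const_mul l)
    have h2 := (((hasDerivAt_pow 4 t).const_mul a).fun_neg).exp
    simpa using h1.fun_mul h2
  have hp : ∀ (t : ℝ) {i n : ℕ}, i ≤ n → |t| ^ i ≤ (1 + |t|) ^ n := fun t i n hin =>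
    (pow_le_pow_left₀ (abs_nonneg t) (by linarith) i).trans
      (pow_le_pow_right₀ (by linarith [abs_nonneg t]) hin)
  have hodd : ∫ t : ℝ, (c * t ^ 5 + l * t) * exp (-(a * t ^ 4)) = 0 := by
    have h := integral_neg_eq_self (fun t : ℝ => (c * t ^ 5 + l * t) * exp (-(a * t ^ 4))) volume
    have h2 : (fun t : ℝ => (c * (-t) ^ 5 + l * -t) * exp (-(a * (-t) ^ 4)))
        = fun t => -((c * t ^ 5 + l * t) * exp (-(a * t ^ 4))) := by
      funext t
      rw [show (-t) ^ 4 = t ^ 4 by ring]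
      ring
    rw [h2, integral_neg] at h
    linarith
  have key := exists_lattice_sum_error hd (by fun_prop) ?_ ?_
  · simpa only [hodd, zero_div, sub_zero] using key
  · refine integrable_of_abs_le_pow_mul_exp (n := 5) (M := |c| + |l|) (by fun_prop) ha fun t => ?_
    rw [abs_mul, abs_of_pos (exp_pos _)]
    gcongr
    refine (abs_add_le _ _).trans ?_
    rw [abs_mul, abs_mul, abs_pow, add_mul]
    gcongr
    · linarith
    · simpa using hp t (i := 1) (n := 5) (by norm_num)
  · refine integrable_of_abs_le_pow_mul_exp (n := 8)
      (M := 5 * |c| + |l| + (|c| + |l|) * (4 * a)) (by fun_prop) ha fun t => ?_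
    rw [show (c * (5 * t ^ 4) + l) * exp (-(a * t ^ 4)) +
        (c * t ^ 5 + l * t) * (exp (-(a * t ^ 4)) * -(a * (4 * t ^ 3)))
      = (5 * c * t ^ 4 + l + -(4 * a * c * t ^ 8) + -(4 * a * l * t ^ 4)) * exp (-(a * t ^ 4)) by
      ring, abs_mul, abs_of_pos (exp_pos _)]
    gcongr
    refine (abs_add_le _ _).trans ((add_le_add (abs_add_three _ _ _) le_rfl).trans ?_)
    rw [abs_neg, abs_neg]
    simp only [abs_mul, abs_pow, abs_of_pos ha, Nat.abs_ofNat]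
    have h4 := hp t (i := 4) (n := 8) (by norm_num)
    have h8 := hp t (i := 8) (n := 8) le_rfl
    have h0 := hp t (i := 0) (n := 8) (by norm_num)
    rw [pow_zero] at h0
    nlinarith [mul_le_mul_of_nonneg_left h4 (abs_nonneg c),
      mul_le_mul_of_nonneg_left h0 (abs_nonneg l),
      mul_le_mul_of_nonneg_left h8 (mul_nonneg ha.le (abs_nonneg c)),
      mul_le_mul_of_nonneg_left h4 (mul_nonneg ha.le (abs_nonneg l))]

theorem abs_exp_sub_one_sub_le (x : ℝ) : |exp x - 1 - x| ≤ x ^ 2 * exp |x| := by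
  have h := Complex.norm_exp_sub_sum_le_norm_mul_exp (x : ℂ) 2
  simp only [Finset.sum_range_succ, Finset.sum_range_zero, pow_zero, pow_one, Nat.factorial,
    Complex.norm_real, Real.norm_eq_abs, sq_abs] at h
  norm_num at h
  rw [← sub_sub] at h
  exact_mod_cast h

theorem abs_quintic_le (c l t : ℝ) : |c * t ^ 5 + l * t| ≤ (|c| + |l|) * (1 + |t|) ^ 5 := by
  have h0 := abs_nonneg t
  refine (abs_add_le _ _).trans ?_
  rw [abs_mul, abs_mul, abs_pow, add_mul]
  gcongr
  · linarith
  · exact (by linarith : |t| ≤ 1 + |t|).trans (le_self_pow₀ (by linarith) (by norm_num))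

/-- First-order expansion of `exp (-a t⁴ + E)` when `E = η (c t⁵ + l t) + O(η²)`, with an error
that is integrable in `t`. -/
theorem exists_abs_exp_perturbed_quartic_sub_le {a : ℝ} (ha : 0 < a) (c l : ℝ) {A : ℝ}
    (hA : 0 ≤ A) :
    ∃ M > 0, ∀ t η E : ℝ, 0 < η → η ≤ 1 →
      |E - η * (c * t ^ 5 + l * t)| ≤ A * η ^ 2 * (1 + |t|) ^ 6 → |E| ≤ a / 2 * t ^ 4 + A →
      |exp (-(a * t ^ 4) + E) - (1 + η * (c * t ^ 5 + l * t)) * exp (-(a * t ^ 4))|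
        ≤ M * η ^ 2 * (1 + t ^ 2)⁻¹ := by
  obtain ⟨C, hC, hCb⟩ := exists_pow_mul_exp_neg_quartic_le 12 (half_pos ha)
  set B := |c| + |l| + A with hB
  have hB0 : 0 ≤ B := by positivity
  refine ⟨(A + B ^ 2 * exp A) * C + 1, by positivity, fun t η E hη hη1 h1 h2 => ?_⟩
  set P := c * t ^ 5 + l * t with hP
  set w := 1 + |t| with hw
  have hw1 : 1 ≤ w := by linarith [abs_nonneg t]
  have hPb : |P| ≤ (|c| + |l|) * w ^ 6 :=
    (abs_quintic_le c l t).trans (by gcongr; norm_num [hw1])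
  have hEb : |E| ≤ B * η * w ^ 6 := by
    calc |E| = |(E - η * P) + η * P| := by ring_nf
      _ ≤ |E - η * P| + |η * P| := abs_add_le _ _
      _ ≤ A * η ^ 2 * w ^ 6 + η * ((|c| + |l|) * w ^ 6) := by
          rw [abs_mul, abs_of_pos hη]; gcongr
      _ ≤ A * η * w ^ 6 + η * ((|c| + |l|) * w ^ 6) := by
          gcongr; nlinarith
      _ = B * η * w ^ 6 := by rw [hB]; ring
  have hE2 : E ^ 2 ≤ B ^ 2 * η ^ 2 * w ^ 12 := by
    rw [← sq_abs]
    calc |E| ^ 2 ≤ (B * η * w ^ 6) ^ 2 := by gcongr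
      _ = _ := by ring
  have hexp : |exp E - 1 - η * P|
      ≤ (A + B ^ 2 * exp A) * η ^ 2 * w ^ 12 * exp (a / 2 * t ^ 4) := by
    have hone : 1 ≤ exp (a / 2 * t ^ 4) := one_le_exp (by positivity)
    calc |exp E - 1 - η * P| = |(exp E - 1 - E) + (E - η * P)| := by ring_nf
      _ ≤ |exp E - 1 - E| + |E - η * P| := abs_add_le _ _
      _ ≤ E ^ 2 * exp |E| + A * η ^ 2 * w ^ 6 := add_le_add (abs_exp_sub_one_sub_le E) h1
      _ ≤ B ^ 2 * η ^ 2 * w ^ 12 * exp (a / 2 * t ^ 4 + A)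
          + A * η ^ 2 * w ^ 12 * exp (a / 2 * t ^ 4) := by
          gcongr ?_ * ?_ + ?_
          · exact exp_le_exp.2 h2
          · calc A * η ^ 2 * w ^ 6 ≤ A * η ^ 2 * w ^ 12 := by gcongr; norm_num [hw1]
              _ ≤ _ := le_mul_of_one_le_right (by positivity) hone
      _ = _ := by rw [exp_add]; ring
  have e1 : exp (-(a * t ^ 4) + E) - (1 + η * P) * exp (-(a * t ^ 4))
      = (exp E - 1 - η * P) * exp (-(a * t ^ 4)) := by rw [exp_add]; ring
  rw [e1, abs_mul, abs_of_pos (exp_pos _)]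
  calc |exp E - 1 - η * P| * exp (-(a * t ^ 4))
      ≤ (A + B ^ 2 * exp A) * η ^ 2 * w ^ 12 * exp (a / 2 * t ^ 4) * exp (-(a * t ^ 4)) := by
        gcongr
    _ = (A + B ^ 2 * exp A) * η ^ 2 * (w ^ 12 * exp (-(a / 2 * t ^ 4))) := by
        rw [mul_assoc _ (exp _), ← exp_add,
          show a / 2 * t ^ 4 + -(a * t ^ 4) = -(a / 2 * t ^ 4) by ring]
        ring
    _ ≤ (A + B ^ 2 * exp A) * η ^ 2 * (C * (1 + t ^ 2)⁻¹) := 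
        mul_le_mul_of_nonneg_left (hCb t) (by positivity)
    _ ≤ _ := by
        have : 0 ≤ η ^ 2 * (1 + t ^ 2)⁻¹ := by positivity
        nlinarith

/-- Far out, the perturbed quartic weight is negligible. -/
theorem exists_abs_quartic_tail_le {a : ℝ} (ha : 0 < a) (c l : ℝ) :
    ∃ M > 0, ∀ t η : ℝ, 0 < η → η ≤ 1 → 1 ≤ η ^ 2 * t ^ 4 →
      |(1 + η * (c * t ^ 5 + l * t)) * exp (-(a * t ^ 4))| ≤ M * η ^ 2 * (1 + t ^ 2)⁻¹ := by
  obtain ⟨C, hC, hCb⟩ := exists_pow_mul_exp_neg_quartic_le 9 ha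
  refine ⟨(1 + (|c| + |l|)) * C, by positivity, fun t η hη hη1 h1 => ?_⟩
  rw [abs_mul, abs_of_pos (exp_pos _)]
  have hw1 : 1 ≤ 1 + |t| := by linarith [abs_nonneg t]
  have ht4 : t ^ 4 ≤ (1 + |t|) ^ 4 := by
    have e : t ^ 4 = |t| ^ 4 := by rw [pow_abs, abs_of_nonneg (by positivity)]
    rw [e]; gcongr; linarith
  have hb : |1 + η * (c * t ^ 5 + l * t)| ≤ (1 + (|c| + |l|)) * (1 + |t|) ^ 5 := by
    refine (abs_add_le _ _).trans ?_
    rw [abs_one, abs_mul, abs_of_pos hη, add_mul, one_mul]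
    refine add_le_add (one_le_pow₀ hw1) ?_
    exact (mul_le_of_le_one_left (abs_nonneg _) hη1).trans (abs_quintic_le c l t)
  calc |1 + η * (c * t ^ 5 + l * t)| * exp (-(a * t ^ 4))
      ≤ (η ^ 2 * t ^ 4) * (|1 + η * (c * t ^ 5 + l * t)| * exp (-(a * t ^ 4))) :=
        le_mul_of_one_le_left (by positivity) h1
    _ ≤ (η ^ 2 * (1 + |t|) ^ 4) *
          ((1 + (|c| + |l|)) * (1 + |t|) ^ 5 * exp (-(a * t ^ 4))) := by gcongr
    _ = (1 + (|c| + |l|)) * η ^ 2 * ((1 + |t|) ^ 9 * exp (-(a * t ^ 4))) := by ring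
    _ ≤ (1 + (|c| + |l|)) * η ^ 2 * (C * (1 + t ^ 2)⁻¹) :=
        mul_le_mul_of_nonneg_left (hCb t) (by positivity)
    _ = _ := by ring

theorem yTerm_pos {p : ℕ} {β h m : ℝ} (hm : m ∈ Set.Ioo (-1 : ℝ) 1) {N k : ℕ} (hk : 0 < k)
    (hkN : k < N) : 0 < yTerm p β h m N k := by
  have hN0 : (0 : ℝ) < N := by exact_mod_cast hk.trans hkN
  have hw : 0 < 1 - m ^ 2 := by nlinarith [hm.1, hm.2]
  have hch : (0 : ℝ) < N.choose k := by exact_mod_cast Nat.choose_pos hkN.le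
  unfold yTerm
  positivity

/-- Exact logarithm of a summand, in terms of `H` and the Stirling errors. -/
theorem log_yTerm_eq {p : ℕ} {β h m : ℝ} (hm : m ∈ Set.Ioo (-1 : ℝ) 1) {N k : ℕ} (hk : 0 < k)
    (hkN : k < N) {x : ℝ} (hx : x = -1 + 2 * (k : ℝ) / N) :
    log (yTerm p β h m N k) = N * (Hfun p β h x - Hfun p β h m)
      + (1 / 2 * log (1 - m ^ 2) - 1 / 2 * log (1 - x ^ 2))
      + ((log (Stirling.stirlingSeq N) - log √π) - (log (Stirling.stirlingSeq k) - log √π)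
        - (log (Stirling.stirlingSeq (N - k)) - log √π)) := by
  have hN0 : (0 : ℝ) < N := by exact_mod_cast hk.trans hkN
  have hw : 0 < 1 - m ^ 2 := by nlinarith [hm.1, hm.2]
  have hch : (0 : ℝ) < N.choose k := by exact_mod_cast Nat.choose_pos hkN.le
  unfold yTerm
  rw [← hx, log_mul (by positivity) (exp_pos _).ne', log_mul (by positivity) hch.ne',
    log_mul (by positivity) (by positivity), log_exp, log_choose_eq hk hkN hx, log_zpow,
    log_sqrt (by positivity), log_sqrt (by positivity), log_div (by positivity) (by norm_num),
    log_mul (by positivity) hw.ne', log_mul (by positivity) hN0.ne']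
  simp only [Hfun]
  push_cast
  ring

/-- The Stirling errors in a binomial coefficient with both parts at least `δ N` are `O(1 / N)`. -/
theorem abs_stirling_errors_le {N k : ℕ} {δ : ℝ} (hδ : 0 < δ) (hkN : k < N) (hN0 : (0 : ℝ) < N)
    (h1 : δ * N ≤ k) (h2 : δ * N ≤ N - k) :
    |(log (Stirling.stirlingSeq N) - log √π) - (log (Stirling.stirlingSeq k) - log √π)
        - (log (Stirling.stirlingSeq (N - k)) - log √π)| ≤ (1 + 2 / δ) / N := by
  have hδN : 0 < δ * N := by positivity
  have hk0 : (0 : ℝ) < k := hδN.trans_le h1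
  have b1 := log_stirlingSeq_sub_le (n := N) (by exact_mod_cast hN0.ne')
  have b2 := log_stirlingSeq_sub_le (n := k) (by exact_mod_cast hk0.ne')
  have b3 := log_stirlingSeq_sub_le (n := N - k) (by omega)
  rw [Nat.cast_sub hkN.le] at b3
  have c2 : 1 / (k : ℝ) ≤ 1 / δ / N := by
    rw [div_div]; exact one_div_le_one_div_of_le hδN h1
  have c3 : 1 / ((N : ℝ) - k) ≤ 1 / δ / N := by
    rw [div_div]; exact one_div_le_one_div_of_le hδN h2
  have e : (1 + 2 / δ) / N = 1 / N + 1 / δ / N + 1 / δ / N := by ring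
  rw [e]
  exact (abs_sub _ _).trans
    (add_le_add ((abs_sub _ _).trans (add_le_add b1 (b2.trans c2))) (b3.trans c3))

/-- Expansion of a summand of `B_N` near the maximizer, in the rescaled variable
`t = N^{1/4} (x - m)`, with `η = N^{-1/4}`. -/
theorem exists_yTerm_expansion {p : ℕ} (hp : 3 ≤ p) {β h m a : ℝ} (hsp : pSpecial p β h m)
    (ha : a = -iteratedDeriv 4 (Hfun p β h) m / 24) :
    ∃ c l : ℝ, ∃ M > 0, ∃ r > 0, ∀ N k : ℕ, ∀ η t : ℝ, 0 < η → η ≤ 1 → N * η ^ 4 = 1 →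
      -1 + 2 * (k : ℝ) / N = m + η * t → |η * t| ≤ r →
      0 < k ∧ k < N ∧
      |yTerm p β h m N k - (1 + η * (c * t ^ 5 + l * t)) * exp (-(a * t ^ 4))|
        ≤ M * η ^ 2 * (1 + t ^ 2)⁻¹ := by
  obtain ⟨d1, d2, d3, d4⟩ := hsp.derivatives hp
  have hm : m ∈ Set.Ioo (-1 : ℝ) 1 := hsp.1.1.1
  have ha0 : 0 < a := by rw [ha]; linarith
  have hm1 : 0 < 1 + m := by linarith [hm.1]
  have hm2 : 0 < 1 - m := by linarith [hm.2]
  obtain ⟨C, hC, r₁, hr₁, hH⟩ := (analyticAt_Hfun p β h hm).taylor_bound 6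
  have hL : AnalyticAt ℝ (fun x : ℝ => 1 / 2 * log (1 - m ^ 2) - 1 / 2 * log (1 - x ^ 2)) m := by
    have a1 : AnalyticAt ℝ (fun x : ℝ => 1 - x ^ 2) m := by fun_prop
    exact analyticAt_const.sub (analyticAt_const.mul (a1.log (by nlinarith)))
  obtain ⟨D, hD, r₂, hr₂, hLb⟩ := hL.taylor_bound 2
  set c := iteratedDeriv 5 (Hfun p β h) m / 120 with hc
  set l := deriv (fun x : ℝ => 1 / 2 * log (1 - m ^ 2) - 1 / 2 * log (1 - x ^ 2)) m with hl
  have e4 : iteratedDeriv 4 (Hfun p β h) m = -24 * a := by rw [ha]; ring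
  have e5 : iteratedDeriv 5 (Hfun p β h) m = 120 * c := by rw [hc]; ring
  simp only [Finset.sum_range_succ, Finset.sum_range_zero, d1, d2, d3, e4, e5,
    iteratedDeriv_zero, iteratedDeriv_one] at hH hLb
  rw [← hl] at hLb
  norm_num [Nat.factorial] at hH hLb
  set δ := min (1 + m) (1 - m) / 4 with hδ
  have hδ0 : 0 < δ := by positivity
  have hδ1 : δ ≤ (1 + m) / 4 := by rw [hδ]; gcongr; exact min_le_left _ _
  have hδ2 : δ ≤ (1 - m) / 4 := by rw [hδ]; gcongr; exact min_le_right _ _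
  set S := 1 + 2 / δ with hS
  have hS0 : 0 < S := by positivity
  obtain ⟨M, hM, hMb⟩ := exists_abs_exp_perturbed_quartic_sub_le ha0 c l
    (A := C + D + |l| + S) (by positivity)
  set q := a / 2 / (|c| + C) with hq
  have hq0 : 0 < q := by positivity
  refine ⟨c, l, M, hM, min (min r₁ r₂) (min (min 1 q) δ), by positivity, ?_⟩
  intro N k η t hη hη1 hN hx hr
  have hrr₁ : |η * t| ≤ r₁ := hr.trans ((min_le_left _ _).trans (min_le_left _ _))
  have hrr₂ : |η * t| ≤ r₂ := hr.trans ((min_le_left _ _).trans (min_le_right _ _))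
  have hr1 : |η * t| ≤ 1 :=
    hr.trans ((min_le_right _ _).trans ((min_le_left _ _).trans (min_le_left _ _)))
  have hrq : |η * t| ≤ q :=
    hr.trans ((min_le_right _ _).trans ((min_le_left _ _).trans (min_le_right _ _)))
  have hrδ := abs_le.1 (hr.trans ((min_le_right _ _).trans (min_le_right _ _)))
  have hN0 : (0 : ℝ) < N := by
    by_contra hneg
    have : (N : ℝ) = 0 := le_antisymm (not_lt.1 hneg) (Nat.cast_nonneg N)
    simp [this] at hN
  have hkval : (k : ℝ) = N * (1 + m + η * t) / 2 := by
    rw [eq_comm, add_assoc 1, ← hx]; field_simp; ring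
  have hk1 : δ * N ≤ k := by rw [hkval]; nlinarith
  have hk2 : δ * N ≤ N - k := by rw [hkval]; nlinarith
  have hδN : 0 < δ * N := by positivity
  have hk0 : 0 < k := by exact_mod_cast hδN.trans_le hk1
  have hkN : k < N := by
    have : (k : ℝ) < N := by linarith
    exact_mod_cast this
  refine ⟨hk0, hkN, ?_⟩
  have hSt := abs_stirling_errors_le hδ0 hkN hN0 hk1 hk2
  have hlog := log_yTerm_eq (p := p) (β := β) (h := h) hm hk0 hkN hx.symm
  set ρ := (log (Stirling.stirlingSeq N) - log √π) - (log (Stirling.stirlingSeq k) - log √π)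
        - (log (Stirling.stirlingSeq (N - k)) - log √π)
  have hH' := hH (η * t) hrr₁
  have hL' := hLb (η * t) hrr₂
  set R := Hfun p β h (m + η * t) - (Hfun p β h m + -(24 * a) / 24 * (η * t) ^ 4
    + 120 * c / 120 * (η * t) ^ 5) with hR
  set Q := 1 / 2 * log (1 - m ^ 2) - 1 / 2 * log (1 - (m + η * t) ^ 2) - l * (η * t) with hQ
  have hρ : |ρ| ≤ S * η ^ 4 := by
    rwa [← hS, div_eq_mul_inv, inv_eq_of_mul_eq_one_right hN] at hSt
  set E := η * (c * t ^ 5 + l * t) + N * R + Q + ρ with hE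
  have hy : yTerm p β h m N k = exp (-(a * t ^ 4) + E) := by
    rw [← exp_log (yTerm_pos (p := p) (β := β) (h := h) hm hk0 hkN), hlog]
    congr 1
    rw [hE, hR, hQ]
    linear_combination (-a * t ^ 4 + c * η * t ^ 5) * hN
  have ht0 := abs_nonneg t
  have hNR : |N * R| ≤ C * η ^ 2 * |t| ^ 6 := by
    rw [abs_mul, abs_of_pos hN0]
    calc (N : ℝ) * |R| ≤ N * (C * |η * t| ^ 6) := by gcongr; simpa [hR, abs_mul] using hH'
      _ = (N * η ^ 4) * (C * η ^ 2 * |t| ^ 6) := by rw [abs_mul, abs_of_pos hη]; ring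
      _ = _ := by rw [hN, one_mul]
  have hQb : |Q| ≤ D * η ^ 2 * |t| ^ 2 := by
    calc |Q| ≤ D * |η * t| ^ 2 := by simpa [hQ, abs_mul, mul_pow] using hL'
      _ = _ := by rw [abs_mul, abs_of_pos hη]; ring
  rw [hy]
  refine hMb t η E hη hη1 ?_ ?_
  · have hw : ∀ i ≤ 6, |t| ^ i ≤ (1 + |t|) ^ 6 := fun i hi =>
      (pow_le_pow_left₀ ht0 (by linarith) i).trans (pow_le_pow_right₀ (by linarith) hi)
    have hη2 : 0 < η ^ 2 := by positivity
    calc |E - η * (c * t ^ 5 + l * t)| = |N * R + Q + ρ| := by rw [hE]; ring_nf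
      _ ≤ |N * R| + |Q| + |ρ| := abs_add_three _ _ _
      _ ≤ C * η ^ 2 * |t| ^ 6 + D * η ^ 2 * |t| ^ 2 + S * η ^ 2 * |t| ^ 0 := by
          refine add_le_add (add_le_add hNR hQb) (hρ.trans ?_)
          rw [pow_zero, mul_one]
          gcongr ?_ * ?_
          exact pow_le_pow_of_le_one hη.le hη1 (by norm_num)
      _ ≤ C * η ^ 2 * (1 + |t|) ^ 6 + D * η ^ 2 * (1 + |t|) ^ 6 + S * η ^ 2 * (1 + |t|) ^ 6 := by
          gcongr ?_ * ?_ + ?_ * ?_ + ?_ * ?_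
          · exact hw 6 le_rfl
          · exact hw 2 (by norm_num)
          · exact hw 0 (by norm_num)
      _ ≤ (C + D + |l| + S) * η ^ 2 * (1 + |t|) ^ 6 := by
          have : 0 ≤ |l| * (η ^ 2 * (1 + |t|) ^ 6) := by positivity
          linarith
  · have hηt : |η * t| = η * |t| := by rw [abs_mul, abs_of_pos hη]
    rw [hηt] at hr1 hrq
    have e6 : t ^ 4 = |t| ^ 4 := by rw [pow_abs, abs_of_nonneg (by positivity)]
    have g1 : |η * (c * t ^ 5)| + |N * R| ≤ a / 2 * t ^ 4 := by
      calc |η * (c * t ^ 5)| + |N * R| ≤ η * (|c| * |t| ^ 5) + C * η ^ 2 * |t| ^ 6 := by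
            rw [abs_mul, abs_mul, abs_of_pos hη, abs_pow]; gcongr
        _ = (|c| * (η * |t|) + C * (η * |t|) * (η * |t|)) * |t| ^ 4 := by ring
        _ ≤ (|c| * q + C * q * 1) * |t| ^ 4 := by gcongr
        _ = a / 2 * t ^ 4 := by rw [e6, hq]; field_simp
    have g2 : |η * (l * t)| ≤ |l| := by
      rw [show η * (l * t) = l * (η * t) by ring, abs_mul, hηt]
      exact mul_le_of_le_one_right (abs_nonneg _) hr1
    have g3 : |Q| ≤ D := by
      refine hQb.trans ?_
      rw [mul_assoc, ← mul_pow]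
      exact mul_le_of_le_one_right hD.le (pow_le_one₀ (by positivity) hr1)
    have g4 : |ρ| ≤ S := hρ.trans (mul_le_of_le_one_right hS0.le (pow_le_one₀ hη.le hη1))
    calc |E| = |(η * (c * t ^ 5) + N * R) + η * (l * t) + (Q + ρ)| := by rw [hE]; ring_nf
      _ ≤ |η * (c * t ^ 5) + N * R| + |η * (l * t)| + |Q + ρ| := abs_add_three _ _ _
      _ ≤ a / 2 * t ^ 4 + |l| + (D + S) :=
          add_le_add (add_le_add ((abs_add_le _ _).trans g1) g2)
            ((abs_add_le _ _).trans (add_le_add g3 g4))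
      _ ≤ _ := by linarith

/-- `B_N` as a sum over all integers. -/
theorem BNsum_eq_tsum_int (p : ℕ) (β h m : ℝ) (N : ℕ) :
    BNsum p β h m N = ∑' k : ℤ, if 0 ≤ k ∧ k ≤ N ∧
      |(-1 + 2 * (k : ℝ) / N) - m| < (N : ℝ) ^ (-(1:ℝ)/4 + (0.24 : ℝ))
      then yTerm p β h m N k.toNat else 0 := by
  rw [← (Nat.cast_injective (R := ℤ)).tsum_eq]
  · rw [tsum_eq_sum (s := Finset.range (N + 1)), BNsum]
    · refine Finset.sum_congr rfl fun k hk => ?_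
      have : k ≤ N := by simpa [Nat.lt_succ_iff] using hk
      simp [Set.indicator_apply, this]
    · intro k hk
      have : ¬ k ≤ N := by simpa [Nat.lt_succ_iff] using hk
      simp [this]
  · intro k hk
    have : 0 ≤ k := by
      by_contra hneg
      simp [hneg] at hk
    exact ⟨k.toNat, Int.toNat_of_nonneg this⟩

theorem abs_tsum_sub_le_of_bound {ι : Type*} {Y G K D : ι → ℝ} {η κ : ℝ} (hG : Summable G)
    (hK : Summable K) (hD : Summable D) (h : ∀ k, |Y k - (G k + η * K k)| ≤ κ * D k) :
    |∑' k, Y k - (∑' k, G k + η * ∑' k, K k)| ≤ κ * ∑' k, D k := by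
  have hGK := hG.add (hK.mul_left η)
  have hd : Summable fun k => Y k - (G k + η * K k) :=
    Summable.of_norm_bounded (hD.mul_left κ) h
  have hY : Summable Y := by simpa using hd.add hGK
  rw [← tsum_mul_left, ← hG.tsum_add (hK.mul_left η), ← hY.tsum_sub hGK, ← Real.norm_eq_abs]
  exact tsum_of_norm_bounded (hD.hasSum.mul_left κ) h

theorem exists_abs_BNsum_sub_le {p : ℕ} (hp : 3 ≤ p) {β h m : ℝ} (hsp : pSpecial p β h m) :
    ∃ C : ℝ, 0 < C ∧ ∃ N₀ : ℕ, ∀ N : ℕ, N₀ ≤ N →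
      |BNsum p β h m N - (N : ℝ) ^ ((3:ℝ)/4) / 2 *
            ∫ t : ℝ, exp (iteratedDeriv 4 (Hfun p β h) m * t ^ 4 / 24)|
        ≤ C * (N : ℝ) ^ ((1:ℝ)/4) := by
  obtain ⟨a, ha⟩ : ∃ a, a = -iteratedDeriv 4 (Hfun p β h) m / 24 := ⟨_, rfl⟩
  have ha0 : 0 < a := by
    have := (hsp.derivatives hp).2.2.2
    rw [ha]; linarith
  obtain ⟨c, l, M₁, hM₁, r, hr, hexp⟩ := exists_yTerm_expansion hp hsp ha
  obtain ⟨M₂, hM₂, htail⟩ := exists_abs_quartic_tail_le ha0 c l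
  obtain ⟨V₁, hV₁, hG⟩ := exists_lattice_sum_error_exp_quartic ha0
  obtain ⟨V₂, hV₂, hK⟩ := exists_lattice_sum_bound_odd ha0 c l
  obtain ⟨V₃, hV₃, hD⟩ := exists_lattice_sum_error_inv_one_add_sq
  have hquart : ∀ t : ℝ, iteratedDeriv 4 (Hfun p β h) m * t ^ 4 / 24 = -(a * t ^ 4) := fun t => by
    rw [ha]; ring
  simp only [hquart]
  set I := ∫ t : ℝ, exp (-(a * t ^ 4))
  have hwin : ∀ᶠ N : ℕ in atTop, (N : ℝ) ^ (-(1:ℝ)/4 + (0.24 : ℝ)) <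
      min r (min (1 + m) (1 - m)) := by
    have hpos : 0 < min r (min (1 + m) (1 - m)) :=
      lt_min hr (lt_min (by linarith [hsp.1.1.1.1]) (by linarith [hsp.1.1.1.2]))
    have h1 : Tendsto (fun x : ℝ => x ^ (-(0.01 : ℝ))) atTop (𝓝 0) :=
      tendsto_rpow_neg_atTop (by norm_num)
    have h2 := (h1.comp tendsto_natCast_atTop_atTop).eventually_lt_const hpos
    refine h2.mono fun N hN => ?_
    rw [show -(1:ℝ)/4 + (0.24 : ℝ) = -(0.01 : ℝ) by norm_num]
    exact hN
  obtain ⟨N₁, hN₁⟩ := eventually_atTop.1 hwin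
  refine ⟨(M₁ + M₂) * (π / 2 + V₃) + V₁ + V₂, by positivity, max N₁ 1, fun N hN => ?_⟩
  have hN1 : (1 : ℝ) ≤ N := by exact_mod_cast (le_max_right _ _).trans hN
  have hN0 : (0 : ℝ) < N := by linarith
  obtain ⟨hwr, hwm⟩ := lt_min_iff.1 (hN₁ N ((le_max_left _ _).trans hN))
  obtain ⟨hwm₁, hwm₂⟩ := lt_min_iff.1 hwm
  set w : ℝ := (N : ℝ) ^ (-(1:ℝ)/4 + (0.24 : ℝ)) with hw
  have hw0 : 0 < w := rpow_pos_of_pos hN0 _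
  set η : ℝ := (N : ℝ) ^ (-(1/4) : ℝ) with hηdef
  have hη : 0 < η := rpow_pos_of_pos hN0 _
  have hη1 : η ≤ 1 := rpow_le_one_of_one_le_of_nonpos hN1 (by norm_num)
  have hNη : N * η ^ 4 = 1 := by
    rw [hηdef, ← rpow_natCast, ← rpow_mul hN0.le]
    norm_num
    rw [rpow_neg_one, mul_inv_cancel₀ hN0.ne']
  have hηw : η ≤ w ^ 2 := by
    rw [hηdef, hw, ← rpow_natCast, ← rpow_mul hN0.le]
    exact rpow_le_rpow_of_exponent_le hN1 (by norm_num)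
  have hη3 : (N : ℝ) ^ ((3:ℝ)/4) = (η ^ 3)⁻¹ := by
    rw [hηdef, ← rpow_natCast, ← rpow_mul hN0.le, ← rpow_neg hN0.le]
    norm_num
  have hη4 : (N : ℝ) ^ ((1:ℝ)/4) = η⁻¹ := by
    rw [hηdef, ← rpow_neg hN0.le]
    norm_num
  set s := 2 * η ^ 3 with hs
  have hs0 : 0 < s := by positivity
  set θ := (-1 - m) / η with hθ
  have hlat : ∀ k : ℤ, -1 + 2 * (k : ℝ) / N = m + η * (θ + k * s) := fun k => by
    rw [div_eq_mul_inv _ (N : ℝ), inv_eq_of_mul_eq_one_right hNη, hθ, hs]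
    field_simp
    ring
  obtain ⟨sG, bG⟩ := hG s hs0 θ
  obtain ⟨sK, bK⟩ := hK s hs0 θ
  obtain ⟨sD, bD⟩ := hD s hs0 θ
  rw [BNsum_eq_tsum_int, ← hw]
  have hmain := abs_tsum_sub_le_of_bound (η := η) (κ := (M₁ + M₂) * η ^ 2)
    (Y := fun k : ℤ => if 0 ≤ k ∧ k ≤ N ∧
      |(-1 + 2 * (k : ℝ) / N) - m| < w
      then yTerm p β h m N k.toNat else 0) sG sK sD fun k => by
    have hdp : 0 ≤ η ^ 2 * (1 + (θ + k * s) ^ 2)⁻¹ := by positivity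
    set t := θ + k * s with ht
    have hfac : exp (-(a * t ^ 4)) + η * ((c * t ^ 5 + l * t) * exp (-(a * t ^ 4)))
      = (1 + η * (c * t ^ 5 + l * t)) * exp (-(a * t ^ 4)) := by ring
    rw [hfac]
    by_cases hcond : 0 ≤ k ∧ k ≤ N ∧
      |(-1 + 2 * (k : ℝ) / N) - m| < w
    · rw [if_pos hcond]
      obtain ⟨hk0, -, hkw⟩ := hcond
      lift k to ℕ using hk0
      rw [hlat, add_sub_cancel_left] at hkw
      refine (hexp N k η t hη hη1 hNη (by rw [ht, ← Int.cast_natCast (R := ℝ) k]; exact hlat k) (hkw.trans hwr).le).2.2.trans ?_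
      nlinarith
    · rw [if_neg hcond, zero_sub, abs_neg]
      have hfar : w ≤ |η * t| := by
        by_contra hlt
        push Not at hlt
        have hx := hlat k
        rw [← ht] at hx
        obtain ⟨h₁, h₂⟩ := abs_lt.1 hlt
        refine hcond ⟨?_, ?_, by rwa [hx, add_sub_cancel_left]⟩
        · have : 0 < 2 * (k : ℝ) / N := by linarith
          have : (0 : ℝ) < k := by
            rw [lt_div_iff₀ hN0] at this
            linarith
          exact_mod_cast this.le
        · have : 2 * (k : ℝ) / N < 2 := by linarith
          have : (k : ℝ) ≤ N := by
            rw [div_lt_iff₀ hN0] at this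
            linarith
          exact_mod_cast this
      have hbig : 1 ≤ η ^ 2 * t ^ 4 := by
        have h₁ : η ^ 2 * 1 ≤ η ^ 2 * (η ^ 2 * t ^ 4) := by
          calc η ^ 2 * 1 = η ^ 2 := mul_one _
            _ ≤ (w ^ 2) ^ 2 := by gcongr
            _ = w ^ 4 := by ring
            _ ≤ |η * t| ^ 4 := by gcongr
            _ = η ^ 2 * (η ^ 2 * t ^ 4) := by rw [Even.pow_abs (by decide)]; ring
        exact le_of_mul_le_mul_left h₁ (by positivity)
      refine (htail t η hη hη1 hbig).trans ?_
      nlinarith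
  set SG := ∑' k : ℤ, exp (-(a * (θ + k * s) ^ 4))
  set SK := ∑' k : ℤ, (c * (θ + k * s) ^ 5 + l * (θ + k * s)) * exp (-(a * (θ + k * s) ^ 4))
  set SD := ∑' k : ℤ, (1 + (θ + k * s) ^ 2)⁻¹
  have hDle : (M₁ + M₂) * η ^ 2 * SD ≤ (M₁ + M₂) * (π / 2 + V₃) * η⁻¹ := by
    have h1 : SD ≤ π / s + V₃ := by linarith [(abs_le.1 bD).2]
    have h2 : η ^ 2 * V₃ ≤ V₃ * η⁻¹ := by
      rw [mul_comm]
      exact mul_le_mul_of_nonneg_left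
        ((pow_le_one₀ hη.le hη1).trans (one_le_inv_iff₀.2 ⟨hη, hη1⟩)) hV₃
    have h3 : η ^ 2 * (π / s) = π / 2 * η⁻¹ := by rw [hs]; field_simp
    calc (M₁ + M₂) * η ^ 2 * SD ≤ (M₁ + M₂) * η ^ 2 * (π / s + V₃) := by gcongr
      _ = (M₁ + M₂) * (η ^ 2 * (π / s) + η ^ 2 * V₃) := by ring
      _ ≤ (M₁ + M₂) * (π / 2 * η⁻¹ + V₃ * η⁻¹) := by rw [h3]; gcongr
      _ = _ := by ring
  have hinv : 1 ≤ η⁻¹ := one_le_inv_iff₀.2 ⟨hη, hη1⟩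
  have hIs : (N : ℝ) ^ ((3:ℝ)/4) / 2 * I = I / s := by rw [hη3, hs]; field_simp
  rw [hIs, hη4]
  have hKη : |η * SK| ≤ V₂ := by
    rw [abs_mul, abs_of_pos hη]
    exact (mul_le_of_le_one_left (abs_nonneg _) hη1).trans bK
  refine (abs_sub_le _ (SG + η * SK) _).trans ?_
  have hlast : |SG + η * SK - I / s| ≤ V₁ + V₂ := by
    rw [show SG + η * SK - I / s = (SG - I / s) + η * SK by ring]
    exact (abs_add_le _ _).trans (add_le_add bG hKη)
  have h12 : V₁ + V₂ ≤ (V₁ + V₂) * η⁻¹ := le_mul_of_one_le_right (by positivity) hinv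
  linarith only [hmain.trans hDle, hlast, h12]

/-- **Laplace-type estimate for `B_N` at a `p`-special point.** -/
theorem BN_estimate
    (p : ℕ) (hp : 3 ≤ p) (β h m : ℝ) (hβ : 0 < β) (hh : 0 < h)
    (hsp : pSpecial p β h m) :
    ∃ C : ℝ, 0 < C ∧ ∃ N₀ : ℕ, ∀ N : ℕ, N₀ ≤ N →
      |BNsum p β h m N -
          (N : ℝ) ^ ((3:ℝ)/4) / 2 *
            ∫ t : ℝ, Real.exp (iteratedDeriv 4 (Hfun p β h) m * t ^ 4 / 24)|
        ≤ C * (N : ℝ) ^ ((1:ℝ)/4) := by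
  obtain ⟨C, hC, N₀, hN₀⟩ := exists_abs_BNsum_sub_le hp hsp
  refine ⟨C, hC, N₀, fun N hN => ?_⟩
  simpa using hN₀ N hN
end
end

section
/- Let p ≥ 3, h = 0 and β > β*(p), let m be a global maximizer of H_{β,0,p} with H''_{β,0,p}(m) < 0 and m ≠ 0, and let A be an open neighborhood of m whose closure contains no other global maximizer of H_{β,0,p}. Let X ~ P_{β,0,p}, X̄ := (Σ_{i=1}^N X_i)/N, W := √N(X̄ − m), g(t) := tanh^{−1}(t)/(p t^{p−1}), a := g'(m), b := g''(m)/(2√N), and β̂ := g(X̄) the maximum pseudolikelihood estimate of β. Then there exists a constant C > 0 such that for all N ≥ 1 and every t ∈ ℝ, P( aW + bW² > t + 1/√N | X̄ ∈ A ) − C/N ≤ P( √N(β̂ − β) > t | X̄ ∈ A ) ≤ P( aW + bW² > t − 1/√N | X̄ ∈ A ) + C/N. -/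
open Real MeasureTheory Filter
open scoped BigOperators Topology

noncomputable section

/-- Second-order Taylor expansion with a cubic remainder bound. -/
lemma exists_taylor_two_bound {f : ℝ → ℝ} {m : ℝ} (hf : ContDiffAt ℝ 3 f m) :
    ∃ K r : ℝ, 0 < K ∧ 0 < r ∧ ∀ x, |x - m| < r →
      |f x - (f m + deriv f m * (x - m) + iteratedDeriv 2 f m / 2 * (x - m) ^ 2)|
        ≤ K * |x - m| ^ 3 := by
  obtain ⟨r, hr, hball⟩ := Metric.eventually_nhds_iff_ball.1 (hf.eventually (by simp))
  have hm : m ∈ Metric.ball m r := Metric.mem_ball_self hr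
  have hon : ContDiffOn ℝ (3 : ℕ) f (Metric.ball m r) :=
    fun x hx => (hball x hx).contDiffWithinAt
  have hT := taylor_isLittleO (convex_ball m r) hm hon
  rw [Metric.isOpen_ball.nhdsWithin_eq hm] at hT
  obtain ⟨r', hr', hb'⟩ := Metric.eventually_nhds_iff_ball.1 (hT.bound one_pos)
  refine ⟨1 + |iteratedDeriv 3 f m| / 6, r', by positivity, hr', fun x hx => ?_⟩
  have h := hb' x (by simpa [Real.dist_eq] using hx)
  simp only [taylorWithinEval_succ, taylor_within_zero_eval, smul_eq_mul,
    iteratedDerivWithin_of_isOpen Metric.isOpen_ball hm, Real.norm_eq_abs, abs_pow] at h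
  norm_num [Nat.factorial] at h
  have h3 : |iteratedDeriv 3 f m / 6 * (x - m) ^ 3| = |iteratedDeriv 3 f m| / 6 * |x - m| ^ 3 := by
    rw [abs_mul, abs_div, abs_pow]; norm_num
  calc _ = |(f x - (f m + (x - m) * deriv f m + 1 / 2 * (x - m) ^ 2 * iteratedDeriv 2 f m
            + 1 / 6 * (x - m) ^ 3 * iteratedDeriv 3 f m))
            + iteratedDeriv 3 f m / 6 * (x - m) ^ 3| := by ring_nf
    _ ≤ _ := (abs_add_le _ _).trans (by rw [h3, add_mul]; exact add_le_add (by simpa using h) le_rfl)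

lemma contDiffAt_gMPL (p : ℕ) (hp : p ≠ 0) {m : ℝ} (hm : m ∈ Set.Ioo (-1 : ℝ) 1) (hm0 : m ≠ 0) :
    ContDiffAt ℝ 3 (gMPL p) m := by
  have h1 : (1 - m) ≠ 0 := by linarith [hm.2]
  have h2 : (1 + m) ≠ 0 := by linarith [hm.1]
  unfold gMPL arctanh
  refine ContDiffAt.div ?_ (by fun_prop) (by positivity)
  refine contDiffAt_const.mul (ContDiffAt.log ?_ (div_ne_zero h2 h1))
  exact ContDiffAt.div (by fun_prop) (by fun_prop) h1

lemma arctanh_eq_log_sub_log {x : ℝ} (hx : x ∈ Set.Ioo (-1 : ℝ) 1) :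
    arctanh x = (1 / 2) * (Real.log (1 + x) - Real.log (1 - x)) := by
  rw [arctanh, Real.log_div (by linarith [hx.1]) (by linarith [hx.2])]

lemma hasDerivAt_binEnt {x : ℝ} (hx : x ∈ Set.Ioo (-1 : ℝ) 1) :
    HasDerivAt binEnt (arctanh x) x := by
  have h1 : (1 - x) ≠ 0 := by linarith [hx.2]
  have h2 : (1 + x) ≠ 0 := by linarith [hx.1]
  have ha : HasDerivAt (fun y : ℝ => 1 + y) 1 x := (hasDerivAt_id x).const_add 1
  have hb : HasDerivAt (fun y : ℝ => 1 - y) (-1) x := (hasDerivAt_id x).const_sub 1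
  have h := ((ha.mul (ha.log h2)).add (hb.mul (hb.log h1))).const_mul (1 / 2 : ℝ)
  rw [arctanh_eq_log_sub_log hx]
  refine h.congr_deriv ?_
  field_simp
  ring

lemma hasDerivAt_Hfun (p : ℕ) (β : ℝ) {x : ℝ} (hx : x ∈ Set.Ioo (-1 : ℝ) 1) :
    HasDerivAt (Hfun p β 0) (β * (p * x ^ (p - 1)) - arctanh x) x := by
  have h := (((hasDerivAt_pow p x).const_mul β).add ((hasDerivAt_id x).const_mul 0)).sub
    (hasDerivAt_binEnt hx)
  exact h.congr_deriv (by simp)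

lemma continuous_Hfun (p : ℕ) (β : ℝ) : Continuous (Hfun p β 0) := by
  have h1 : Continuous fun x : ℝ => (1 + x) * Real.log (1 + x) :=
    Real.continuous_mul_log.comp (by fun_prop : Continuous fun x : ℝ => 1 + x)
  have h2 : Continuous fun x : ℝ => (1 - x) * Real.log (1 - x) :=
    Real.continuous_mul_log.comp (by fun_prop : Continuous fun x : ℝ => 1 - x)
  unfold Hfun binEnt
  fun_prop

/-- The stationarity equation satisfied by a maximizer. -/
lemma isMaximizer.stationary {p : ℕ} {β m : ℝ} (h : isMaximizer p β 0 m) :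
    arctanh m = β * (p * m ^ (p - 1)) := by
  have hloc : IsLocalMax (Hfun p β 0) m := by
    filter_upwards [Ioo_mem_nhds h.1.1 h.1.2] with x hx
    exact h.2 x (Set.Ioo_subset_Icc_self hx)
  linarith [hloc.hasDerivAt_eq_zero (hasDerivAt_Hfun p β h.1)]

lemma isMaximizer.gMPL_eq {p : ℕ} (hp : p ≠ 0) {β m : ℝ} (h : isMaximizer p β 0 m)
    (hm0 : m ≠ 0) : gMPL p m = β := by
  rw [gMPL, h.stationary, mul_div_assoc, div_self (by positivity), mul_one]

/-- Near a nondegenerate maximizer, `H` lies below a downward parabola. -/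
lemma exists_local_quadratic_bound {p : ℕ} {β m : ℝ} (h : isMaximizer p β 0 m)
    (hH : iteratedDeriv 2 (Hfun p β 0) m < 0) :
    ∃ c r : ℝ, 0 < c ∧ 0 < r ∧ ∀ x, |x - m| < r →
      Hfun p β 0 x ≤ Hfun p β 0 m - c * (x - m) ^ 2 := by
  set d := iteratedDeriv 2 (Hfun p β 0) m with hd
  have hev : deriv (Hfun p β 0) =ᶠ[𝓝 m] fun x => β * (p * x ^ (p - 1)) - arctanh x := by
    filter_upwards [Ioo_mem_nhds h.1.1 h.1.2] with x hx
    exact (hasDerivAt_Hfun p β hx).deriv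
  let F : ℝ → ℝ := fun x => Hfun p β 0 x + (-d / 4) * (x - m) ^ 2
  have hsq : ∀ x, HasDerivAt (fun x : ℝ => (-d / 4) * (x - m) ^ 2) ((-d / 2) * (x - m)) x := by
    intro x
    refine ((((hasDerivAt_id x).sub_const m).pow 2).const_mul (-d / 4)).congr_deriv ?_
    simp
    ring
  have hevF : deriv F =ᶠ[𝓝 m] fun x => deriv (Hfun p β 0) x + (-d / 2) * (x - m) := by
    filter_upwards [Ioo_mem_nhds h.1.1 h.1.2] with x hx
    have hx' := hasDerivAt_Hfun p β hx
    rw [hx'.deriv]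
    exact (hx'.add (hsq x)).deriv
  have hdd : deriv (deriv (Hfun p β 0)) m = d := by
    rw [hd, iteratedDeriv_succ, iteratedDeriv_one]
  have hdiff : DifferentiableAt ℝ (deriv (Hfun p β 0)) m :=
    differentiableAt_of_deriv_ne_zero (hdd ▸ hH.ne)
  have hF2 : deriv (deriv F) m < 0 := by
    rw [hevF.deriv_eq]
    have h1 : HasDerivAt (fun x => (-d / 2) * (x - m)) (-d / 2) m := by
      simpa using ((hasDerivAt_id m).sub_const m).const_mul (-d / 2)
    have h2 := (hdiff.hasDerivAt.add h1).deriv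
    rw [hdd] at h2
    have h3 : deriv (fun x => deriv (Hfun p β 0) x + (-d / 2) * (x - m)) m = d + -d / 2 := h2
    rw [h3]; linarith
  have hF1 : deriv F m = 0 := by
    rw [hevF.eq_of_nhds, hev.eq_of_nhds, h.stationary]; ring
  have hFc : ContinuousAt F m := by
    have := continuous_Hfun p β
    exact Continuous.continuousAt (by fun_prop)
  have hmax := isLocalMax_of_deriv_deriv_neg hF2 hF1 hFc
  obtain ⟨r, hr, hb⟩ := Metric.eventually_nhds_iff_ball.1 hmax
  refine ⟨-d / 4, r, by linarith, hr, fun x hx => ?_⟩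
  have := hb x (by simpa [Real.dist_eq] using hx)
  simp only [F, sub_self] at this
  linarith

lemma exists_Hfun_gt_one (p : ℕ) (β : ℝ) :
    ∃ x ∈ Set.Ioo (-1 : ℝ) 1, Hfun p β 0 1 < Hfun p β 0 x := by
  set e := Real.exp (-2 * (|β| * p) - Real.log 2 / 2) with he
  have hl2 : 0 < Real.log 2 := Real.log_pos one_lt_two
  have he0 : 0 < e := Real.exp_pos _
  have he1 : e < 1 := by
    rw [he, Real.exp_lt_one_iff]
    have : 0 ≤ |β| * p := by positivity
    linarith
  have hlog : Real.log e = -2 * (|β| * p) - Real.log 2 / 2 := Real.log_exp _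
  refine ⟨1 - e, ⟨by linarith, by linarith⟩, ?_⟩
  have hbern : 1 - p * e ≤ (1 - e) ^ p := by
    have := one_add_mul_le_pow (a := -e) (by linarith) p
    calc _ = 1 + (p : ℝ) * -e := by ring
      _ ≤ _ := this
      _ = _ := by ring
  have hle1 : (1 - e) ^ p ≤ 1 := pow_le_one₀ (by linarith) (by linarith)
  have hβ : -(|β| * p * e) ≤ β * ((1 - e) ^ p - 1) := by
    have h1 : |β * ((1 - e) ^ p - 1)| ≤ |β| * (p * e) := by
      rw [abs_mul]
      refine mul_le_mul_of_nonneg_left ?_ (abs_nonneg _)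
      rw [abs_le]; constructor <;> nlinarith [abs_nonneg β]
    linarith [(abs_le.1 h1).1]
  have hlog2 : (2 - e) * Real.log (2 - e) ≤ (2 - e) * Real.log 2 :=
    mul_le_mul_of_nonneg_left (Real.log_le_log (by linarith) (by linarith)) (by linarith)
  have h0 : 0 < e * Real.log 2 := by positivity
  have hval : Hfun p β 0 1 = β - Real.log 2 := by
    simp only [Hfun, binEnt]
    norm_num
    ring
  have hvale : Hfun p β 0 (1 - e) =
      β * (1 - e) ^ p - 1 / 2 * ((2 - e) * Real.log (2 - e) + e * Real.log e) := by
    simp only [Hfun, binEnt]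
    ring_nf
  rw [hval, hvale, hlog]
  nlinarith

lemma Hfun_neg (p : ℕ) (β x : ℝ) : Hfun p β 0 (-x) = Hfun p (β * (-1) ^ p) 0 x := by
  simp only [Hfun, binEnt, neg_pow x]
  ring_nf

/-- A point of `[-1, 1]` where `H` is maximal is not an endpoint. -/
lemma isMaximizer_of_isMaxOn {p : ℕ} {β x : ℝ} (hx : x ∈ Set.Icc (-1 : ℝ) 1)
    (h : ∀ y ∈ Set.Icc (-1 : ℝ) 1, Hfun p β 0 y ≤ Hfun p β 0 x) : isMaximizer p β 0 x := by
  refine ⟨⟨lt_of_le_of_ne hx.1 ?_, lt_of_le_of_ne hx.2 ?_⟩, h⟩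
  · rintro rfl
    obtain ⟨y, hy, hlt⟩ := exists_Hfun_gt_one p (β * (-1) ^ p)
    rw [← Hfun_neg, ← Hfun_neg] at hlt
    exact absurd (h (-y) ⟨by linarith [hy.2], by linarith [hy.1]⟩) (not_le.2 hlt)
  · rintro rfl
    obtain ⟨y, hy, hlt⟩ := exists_Hfun_gt_one p β
    exact absurd (h y (Set.Ioo_subset_Icc_self hy)) (not_le.2 hlt)

/-- On a set whose closure contains no other maximizer, `H` lies below a downward parabola
touching it at the nondegenerate maximizer. -/
lemma exists_quadratic_bound {p : ℕ} {β m : ℝ} (h : isMaximizer p β 0 m)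
    (hH : iteratedDeriv 2 (Hfun p β 0) m < 0) {A : Set ℝ}
    (hA : ∀ x ∈ closure A, isMaximizer p β 0 x → x = m) :
    ∃ c : ℝ, 0 < c ∧ ∀ x ∈ A, x ∈ Set.Icc (-1 : ℝ) 1 →
      Hfun p β 0 x ≤ Hfun p β 0 m - c * (x - m) ^ 2 := by
  obtain ⟨c, r, hc, hr, hloc⟩ := exists_local_quadratic_bound h hH
  set K : Set ℝ := (Set.Icc (-1 : ℝ) 1 ∩ closure A) ∩ {x | r ≤ |x - m|}
  have hKc : IsCompact K :=
    (isCompact_Icc.inter_right isClosed_closure).inter_right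
      (isClosed_le continuous_const (by fun_prop))
  have hfar : ∃ η : ℝ, 0 < η ∧ ∀ x ∈ K, Hfun p β 0 x ≤ Hfun p β 0 m - η := by
    rcases K.eq_empty_or_nonempty with hE | hne
    · exact ⟨1, one_pos, by simp [hE]⟩
    · obtain ⟨z, hz, hzmax⟩ := hKc.exists_isMaxOn hne (continuous_Hfun p β).continuousOn
      refine ⟨Hfun p β 0 m - Hfun p β 0 z, ?_, fun x hx => ?_⟩
      swap
      · have : Hfun p β 0 x ≤ Hfun p β 0 z := hzmax hx
        linarith
      refine sub_pos.2 (lt_of_le_of_ne (h.2 z hz.1.1) fun heq => ?_)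
      have hzm := hA z hz.1.2 (isMaximizer_of_isMaxOn hz.1.1 fun y hy => heq ▸ h.2 y hy)
      have := hz.2
      simp only [hzm, Set.mem_ofPred_eq, sub_self, abs_zero] at this
      linarith
  obtain ⟨η, hη, hKη⟩ := hfar
  refine ⟨min c (η / 4), by positivity, fun x hxA hx => ?_⟩
  have hs : (x - m) ^ 2 ≤ 4 := by
    have := h.1; nlinarith [hx.1, hx.2, this.1, this.2]
  by_cases hxr : |x - m| < r
  · have := hloc x hxr
    nlinarith [min_le_left c (η / 4), sq_nonneg (x - m)]
  · have := hKη x ⟨⟨hx, subset_closure hxA⟩, not_lt.1 hxr⟩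
    nlinarith [min_le_right c (η / 4), sq_nonneg (x - m)]

/-- Sums over configurations of a function of the empirical mean are binomial sums. -/
lemma sum_comp_mag (N : ℕ) (F : ℝ → ℝ) :
    ∑ σ : Fin N → Bool, F (mag σ / N) =
      ∑ k ∈ Finset.range (N + 1), (N.choose k : ℝ) * F ((2 * k - N) / N) := by
  have hmag : ∀ σ : Fin N → Bool,
      mag σ = 2 * ((Finset.univ.filter fun i => σ i = true).card : ℝ) - N := by
    intro σ
    have : ∀ i, spin (σ i) = 2 * (if σ i = true then (1 : ℝ) else 0) - 1 := by
      intro i; unfold spin; split_ifs <;> norm_num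
    simp only [mag, this, Finset.sum_sub_distrib, ← Finset.mul_sum, Finset.sum_boole]
    simp
  have h := Finset.sum_powerset_apply_card (fun k => F ((2 * k - N) / N))
    (x := (Finset.univ : Finset (Fin N)))
  simp only [Finset.card_univ, Fintype.card_fin, nsmul_eq_mul] at h
  rw [← h]
  refine Finset.sum_nbij' (fun σ => Finset.univ.filter fun i => σ i = true)
    (fun s i => decide (i ∈ s)) (by simp) (by simp) ?_ ?_ ?_
  · intro σ _; ext i; simp
  · intro s _; ext i; simp
  · intro σ _; rw [hmag]

lemma cwWeight_eq (p : ℕ) {N : ℕ} (hN : 1 ≤ N) (β : ℝ) (σ : Fin N → Bool) :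
    cwWeight p N β 0 σ = Real.exp (N * (β * (mag σ / N) ^ p)) := by
  have hN0 : (N : ℝ) ≠ 0 := by positivity
  rw [cwWeight, cwHamiltonian, ← Fintype.sum_pow fun i => spin (σ i), ← mag, zpow_sub₀ hN0]
  congr 1
  simp only [zpow_one, zpow_natCast, div_pow]
  field_simp
  ring

/-- The unnormalized mass of an event. -/
def cwMass (p N : ℕ) (β : ℝ) (E : Set (Fin N → Bool)) : ℝ :=
  ∑ x : Fin N → Bool, E.indicator (cwWeight p N β 0) x

lemma cwWeight_pos (p N : ℕ) (β h : ℝ) (σ : Fin N → Bool) : 0 < cwWeight p N β h σ :=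
  Real.exp_pos _

lemma cwMass_nonneg (p N : ℕ) (β : ℝ) (E : Set (Fin N → Bool)) : 0 ≤ cwMass p N β E :=
  Finset.sum_nonneg fun _ _ => Set.indicator_nonneg (fun _ _ => (cwWeight_pos ..).le) _

lemma cwMass_mono (p N : ℕ) (β : ℝ) {E F : Set (Fin N → Bool)} (h : E ⊆ F) :
    cwMass p N β E ≤ cwMass p N β F :=
  Finset.sum_le_sum fun _ _ =>
    Set.indicator_le_indicator_of_subset h (fun _ => (cwWeight_pos ..).le) _

lemma cwMass_union_le (p N : ℕ) (β : ℝ) (E F : Set (Fin N → Bool)) :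
    cwMass p N β (E ∪ F) ≤ cwMass p N β E + cwMass p N β F := by
  rw [cwMass, cwMass, cwMass, ← Finset.sum_add_distrib]
  refine Finset.sum_le_sum fun x _ => ?_
  have := (cwWeight_pos p N β 0 x).le
  by_cases hE : x ∈ E <;> by_cases hF : x ∈ F <;> simp [hE, hF, this]

lemma cwCondProb_eq (p N : ℕ) (β : ℝ) (E A : Set (Fin N → Bool)) :
    cwCondProb p N β 0 E A = cwMass p N β (E ∩ A) / cwMass p N β A := by
  have hZ : (∑ x : Fin N → Bool, cwWeight p N β 0 x) ≠ 0 :=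
    (Finset.sum_pos (fun _ _ => cwWeight_pos ..) Finset.univ_nonempty).ne'
  exact div_div_div_cancel_right₀ hZ _ _

lemma cwCondProb_le_add (p N : ℕ) (β : ℝ) {E F B A : Set (Fin N → Bool)}
    (h : E ∩ A ⊆ F ∪ B) :
    cwCondProb p N β 0 E A ≤ cwCondProb p N β 0 F A + cwCondProb p N β 0 B A := by
  simp only [cwCondProb_eq, ← add_div]
  refine div_le_div_of_nonneg_right ?_ (cwMass_nonneg ..)
  refine (cwMass_mono p N β ?_).trans (cwMass_union_le ..)
  rw [← Set.union_inter_distrib_right]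
  exact fun x hx => ⟨h hx, hx.2⟩

lemma cwCondProb_le_one (p N : ℕ) (β : ℝ) (E A : Set (Fin N → Bool)) :
    cwCondProb p N β 0 E A ≤ 1 := by
  rw [cwCondProb_eq]
  exact div_le_one_of_le₀ (cwMass_mono _ _ _ Set.inter_subset_right) (cwMass_nonneg ..)

lemma cwMass_eq_sum (p : ℕ) {N : ℕ} (hN : 1 ≤ N) (β : ℝ) (S : Set ℝ) :
    cwMass p N β {σ | mag σ / N ∈ S} = ∑ k ∈ Finset.range (N + 1),
      (N.choose k : ℝ) * S.indicator (fun x => Real.exp (N * (β * x ^ p))) ((2 * k - N) / N) := by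
  rw [← sum_comp_mag, cwMass]
  refine Finset.sum_congr rfl fun σ _ => ?_
  by_cases h : mag σ / N ∈ S <;> simp [h, cwWeight_eq p hN]

/-- The entropy bound on binomial coefficients. -/
lemma choose_mul_exp_binEnt_le {N k : ℕ} (hN : 1 ≤ N) (hk : k ≤ N) :
    (N.choose k : ℝ) * Real.exp (N * binEnt ((2 * k - N) / N)) ≤ 2 ^ N := by
  have hN0 : (0 : ℝ) < N := by positivity
  have hkN : (k : ℝ) ≤ N := by exact_mod_cast hk
  have hexp : ∀ (j : ℕ), Real.exp (j * Real.log (2 * (j / N))) = (2 * ((j : ℝ) / N)) ^ j := by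
    intro j
    rcases Nat.eq_zero_or_pos j with rfl | hj
    · simp
    · rw [Real.exp_nat_mul, Real.exp_log (by positivity)]
  have hI : N * binEnt ((2 * k - N) / N) =
      k * Real.log (2 * (k / N)) + (N - k : ℕ) * Real.log (2 * ((N - k : ℕ) / N)) := by
    have h1 : 1 + (2 * (k : ℝ) - N) / N = 2 * (k / N) := by field_simp; ring
    have h2 : 1 - (2 * (k : ℝ) - N) / N = 2 * ((N - k : ℕ) / N) := by
      rw [Nat.cast_sub hk]; field_simp; ring
    rw [binEnt, h1, h2]
    field_simp
  rw [hI, Real.exp_add, hexp, hexp, mul_pow, mul_pow]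
  have hpow : (2 : ℝ) ^ N = 2 ^ k * 2 ^ (N - k) := by rw [← pow_add, Nat.add_sub_cancel' hk]
  have hone : ((k : ℝ) / N) ^ k * (((N - k : ℕ) : ℝ) / N) ^ (N - k) * N.choose k ≤ 1 := by
    have hs := add_pow ((k : ℝ) / N) (((N - k : ℕ) : ℝ) / N) N
    have h1 : (k : ℝ) / N + ((N - k : ℕ) : ℝ) / N = 1 := by
      rw [Nat.cast_sub hk]; field_simp; ring
    rw [h1, one_pow] at hs
    rw [hs]
    exact Finset.single_le_sum (f := fun j => ((k : ℝ) / N) ^ j *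
      (((N - k : ℕ) : ℝ) / N) ^ (N - j) * N.choose j) (fun _ _ => by positivity)
      (Finset.mem_range.2 (by omega))
  rw [hpow]
  calc _ = 2 ^ k * 2 ^ (N - k) *
        (((k : ℝ) / N) ^ k * (((N - k : ℕ) : ℝ) / N) ^ (N - k) * N.choose k) := by ring
    _ ≤ _ := mul_le_of_le_one_right (by positivity) hone

lemma two_pow_mul_tilt {N k : ℕ} (hN : 1 ≤ N) (hk : k ≤ N) {m : ℝ} (hm : m ∈ Set.Ioo (-1 : ℝ) 1) :
    2 ^ N * (((1 + m) / 2) ^ k * (1 - (1 + m) / 2) ^ (N - k)) =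
      Real.exp (N * (binEnt m + arctanh m * ((2 * k - N) / N - m))) := by
  have hN0 : (0 : ℝ) < N := by positivity
  have h1 : 0 < 1 + m := by linarith [hm.1]
  have h2 : 0 < 1 - m := by linarith [hm.2]
  have hpow : (2 : ℝ) ^ N = 2 ^ k * 2 ^ (N - k) := by rw [← pow_add, Nat.add_sub_cancel' hk]
  have hE : N * (binEnt m + arctanh m * ((2 * k - N) / N - m)) =
      k * Real.log (1 + m) + (N - k : ℕ) * Real.log (1 - m) := by
    rw [arctanh_eq_log_sub_log hm, binEnt, Nat.cast_sub hk]
    field_simp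
    ring
  rw [hE, Real.exp_add, Real.exp_nat_mul, Real.exp_nat_mul, Real.exp_log h1, Real.exp_log h2, hpow]
  calc _ = (2 * ((1 + m) / 2)) ^ k * (2 * (1 - (1 + m) / 2)) ^ (N - k) := by
        rw [mul_pow, mul_pow]; ring
    _ = _ := by ring_nf

/-- A Chebyshev-type lower bound for the binomial distribution with mean parameter `m`. -/
lemma half_le_sum_binomial {N : ℕ} (hN : 1 ≤ N) (m : ℝ) :
    1 / 2 ≤ ∑ k ∈ Finset.range (N + 1), (N.choose k : ℝ) *
      (((1 + m) / 2) ^ k * (1 - (1 + m) / 2) ^ (N - k)) *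
        (1 - N * ((2 * k - N) / N - m) ^ 2 / 2) := by
  have hN0 : (0 : ℝ) < N := by positivity
  set q : ℝ := (1 + m) / 2 with hq
  have hm : m = 2 * q - 1 := by rw [hq]; ring
  have h1 := congrArg (Polynomial.eval q) (bernsteinPolynomial.sum ℝ N)
  have h2 := congrArg (Polynomial.eval q) (bernsteinPolynomial.variance ℝ N)
  simp only [bernsteinPolynomial, Polynomial.eval_finsetSum, Polynomial.eval_mul,
    Polynomial.eval_pow, Polynomial.eval_sub, Polynomial.eval_X, Polynomial.eval_one,
    Polynomial.eval_natCast, nsmul_eq_mul] at h1 h2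
  have hterm : ∀ k : ℕ, (N.choose k : ℝ) * (q ^ k * (1 - q) ^ (N - k)) *
        (1 - N * ((2 * k - N) / N - m) ^ 2 / 2) =
      N.choose k * q ^ k * (1 - q) ^ (N - k) -
        2 / N * ((N * q - k) ^ 2 * (N.choose k * q ^ k * (1 - q) ^ (N - k))) := by
    intro k
    rw [hm]
    field_simp
    ring
  simp only [hterm, Finset.sum_sub_distrib, ← Finset.mul_sum, h1, h2]
  have : 2 / (N : ℝ) * (N * q * (1 - q)) = 2 * (q * (1 - q)) := by field_simp
  rw [this]
  nlinarith [sq_nonneg (2 * q - 1)]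

/-- Second-order lower bound for a monomial. -/
lemma exists_pow_taylor_bound (m : ℝ) (n : ℕ) :
    ∃ L : ℝ, 0 ≤ L ∧ ∀ x ∈ Set.Icc (-1 : ℝ) 1,
      |x ^ n - m ^ n - n * m ^ (n - 1) * (x - m)| ≤ L * (x - m) ^ 2 := by
  induction n with
  | zero => exact ⟨0, le_rfl, by simp⟩
  | succ n ih =>
    obtain ⟨L, hL, h⟩ := ih
    refine ⟨L + |n * m ^ (n - 1)|, by positivity, fun x hx => ?_⟩
    have hmn : (n : ℝ) * m ^ (n - 1) * m = n * m ^ n := by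
      rcases n with _ | n
      · simp
      · simp [pow_succ, mul_assoc]
    have key : x ^ (n + 1) - m ^ (n + 1) - (n + 1 : ℕ) * m ^ (n + 1 - 1) * (x - m) =
        x * (x ^ n - m ^ n - n * m ^ (n - 1) * (x - m)) + n * m ^ (n - 1) * (x - m) ^ 2 := by
      push_cast
      linear_combination (x - m) * hmn
    rw [key, add_mul]
    refine (abs_add_le _ _).trans (add_le_add ?_ ?_)
    · rw [abs_mul]
      exact (mul_le_of_le_one_left (abs_nonneg _) (abs_le.2 hx)).trans (h x hx)
    · rw [abs_mul, abs_of_nonneg (sq_nonneg (x - m))]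

lemma mean_mem_Icc {N k : ℕ} (hN : 1 ≤ N) (hk : k ≤ N) :
    (2 * (k : ℝ) - N) / N ∈ Set.Icc (-1 : ℝ) 1 := by
  have hN0 : (0 : ℝ) < N := by positivity
  have hkN : (k : ℝ) ≤ N := by exact_mod_cast hk
  have hk0 : (0 : ℝ) ≤ k := by positivity
  constructor
  · rw [le_div_iff₀ hN0]; linarith
  · rw [div_le_iff₀ hN0]; linarith

/-- Lower bound for the mass of a neighborhood of the maximizer. -/
lemma exists_le_cwMass {p : ℕ} {β m : ℝ} (h : isMaximizer p β 0 m) {A : Set ℝ}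
    (hA : IsOpen A) (hmA : m ∈ A) :
    ∃ κ : ℝ, ∃ N₀ : ℕ, 0 < κ ∧ ∀ N : ℕ, 1 ≤ N → N₀ ≤ N →
      κ * (2 ^ N * Real.exp (N * Hfun p β 0 m)) ≤ cwMass p N β {σ | mag σ / N ∈ A} := by
  obtain ⟨r, hr, hball⟩ := Metric.isOpen_iff.1 hA m hmA
  obtain ⟨L, hL, hLb⟩ := exists_pow_taylor_bound m p
  obtain ⟨N₀, hN₀⟩ := exists_nat_gt (2 / r ^ 2)
  refine ⟨Real.exp (-(2 * (|β| * L))) / 2, N₀, by positivity, fun N hN hNN => ?_⟩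
  have hN0 : (0 : ℝ) < N := by positivity
  have hNr : 2 / r ^ 2 < N := hN₀.trans_le (by exact_mod_cast hNN)
  rw [cwMass_eq_sum p hN]
  set M := 2 ^ N * Real.exp (N * Hfun p β 0 m) * Real.exp (-(2 * (|β| * L))) with hM
  have hM0 : 0 < M := by positivity
  have hq0 : 0 < (1 + m) / 2 := by linarith [h.1.1]
  have hq1 : 0 < 1 - (1 + m) / 2 := by linarith [h.1.2]
  calc _ = M * (1 / 2) := by rw [hM]; ring
    _ ≤ M * _ := mul_le_mul_of_nonneg_left (half_le_sum_binomial hN m) hM0.le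
    _ = _ := Finset.mul_sum _ _ _
    _ ≤ _ := Finset.sum_le_sum fun k hk => ?_
  have hkN : k ≤ N := by simpa [Nat.lt_succ_iff] using hk
  have hx := mean_mem_Icc hN hkN
  have htilt := two_pow_mul_tilt hN hkN h.1
  set x := (2 * (k : ℝ) - N) / N
  set B := ((1 + m) / 2) ^ k * (1 - (1 + m) / 2) ^ (N - k)
  have hB : 0 < B := by positivity
  have hind : 0 ≤ (N.choose k : ℝ) * A.indicator (fun x => Real.exp (N * (β * x ^ p))) x :=
    mul_nonneg (by positivity) (Set.indicator_nonneg (fun _ _ => (Real.exp_pos _).le) _)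
  by_cases hclose : N * (x - m) ^ 2 ≤ 2
  · have hxA : x ∈ A := by
      refine hball ?_
      rw [Metric.mem_ball, Real.dist_eq]
      refine abs_lt_of_sq_lt_sq ?_ hr.le
      rw [div_lt_iff₀ (by positivity)] at hNr
      have := hclose.trans_lt hNr
      exact lt_of_mul_lt_mul_left this hN0.le
    rw [Set.indicator_of_mem hxA]
    have hβ : -(|β| * L * (x - m) ^ 2) ≤ β * (x ^ p - m ^ p - p * m ^ (p - 1) * (x - m)) := by
      have := mul_le_mul_of_nonneg_left (hLb x hx) (abs_nonneg β)
      rw [← abs_mul] at this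
      linarith [(abs_le.1 this).1]
    have hexp : M * B ≤ Real.exp (N * (β * x ^ p)) := by
      have : M * B = Real.exp (N * Hfun p β 0 m + -(2 * (|β| * L)) +
          N * (binEnt m + arctanh m * (x - m))) := by
        rw [Real.exp_add, Real.exp_add, ← htilt, hM]; ring
      rw [this, Real.exp_le_exp, h.stationary, Hfun]
      have h1 : |β| * L * (N * (x - m) ^ 2) ≤ |β| * L * 2 :=
        mul_le_mul_of_nonneg_left hclose (by positivity)
      have h2 := mul_le_mul_of_nonneg_left hβ hN0.le
      linarith
    calc _ = N.choose k * (M * B) * (1 - N * (x - m) ^ 2 / 2) := by ring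
      _ ≤ N.choose k * (M * B) := mul_le_of_le_one_right (by positivity) (by
          have : 0 ≤ N * (x - m) ^ 2 := by positivity
          linarith)
      _ ≤ _ := mul_le_mul_of_nonneg_left hexp (by positivity)
  · refine le_trans ?_ hind
    refine mul_nonpos_of_nonneg_of_nonpos hM0.le ?_
    exact mul_nonpos_of_nonneg_of_nonpos (by positivity) (by linarith [not_le.1 hclose])

/-- Upper bound for the mass of the configurations in `A` that are far from the maximizer. -/
lemma cwMass_far_le {p : ℕ} {β m c K : ℝ} (hc : 0 < c) (hK : 0 < K) {A : Set ℝ}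
    (hA : ∀ x ∈ A, x ∈ Set.Icc (-1 : ℝ) 1 → Hfun p β 0 x ≤ Hfun p β 0 m - c * (x - m) ^ 2)
    {N : ℕ} (hN : 1 ≤ N) :
    cwMass p N β {σ | mag σ / N ∈ A ∩ {x | 1 < K * N * |x - m| ^ 3}} ≤
      1440 * K ^ 4 / c ^ 6 / N * (2 ^ N * Real.exp (N * Hfun p β 0 m)) := by
  have hN0 : (0 : ℝ) < N := by positivity
  have hN1 : (1 : ℝ) ≤ N := by exact_mod_cast hN
  set M := 2 ^ N * Real.exp (N * Hfun p β 0 m)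
  have hM : 0 < M := by positivity
  set D := 720 * K ^ 4 / (c ^ 6 * N ^ 2) * M with hD
  have hD0 : 0 ≤ D := by positivity
  rw [cwMass_eq_sum p hN]
  calc _ ≤ ∑ k ∈ Finset.range (N + 1), D := Finset.sum_le_sum fun k hk => ?_
    _ = (N + 1) * D := by simp
    _ ≤ (2 * N) * D := by gcongr; linarith
    _ = _ := by rw [hD]; field_simp; ring
  have hkN : k ≤ N := by simpa [Nat.lt_succ_iff] using hk
  have hx := mean_mem_Icc hN hkN
  have hch := choose_mul_exp_binEnt_le hN hkN
  set x := (2 * (k : ℝ) - N) / N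
  by_cases hxS : x ∈ A ∩ {x | 1 < K * N * |x - m| ^ 3}
  swap
  · simpa [Set.indicator_of_notMem hxS] using hD0
  rw [Set.indicator_of_mem hxS]
  have hfar : 1 < K * N * |x - m| ^ 3 := hxS.2
  have hH := hA x hxS.1 hx
  set y := N * (c * (x - m) ^ 2)
  have hy0 : 0 ≤ y := by positivity
  have hy6 : c ^ 6 * N ^ 2 ≤ y ^ 6 * K ^ 4 := by
    have h4 : 1 ≤ (K * N * |x - m| ^ 3) ^ 4 := one_le_pow₀ hfar.le
    have h12 : |x - m| ^ 12 = (x - m) ^ 12 := Even.pow_abs (by decide) _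
    calc c ^ 6 * N ^ 2 ≤ c ^ 6 * N ^ 2 * (K * N * |x - m| ^ 3) ^ 4 :=
          le_mul_of_one_le_right (by positivity) h4
      _ = c ^ 6 * N ^ 6 * K ^ 4 * |x - m| ^ 12 := by ring
      _ = _ := by rw [h12]; ring
  have hexpy : Real.exp (-y) ≤ 720 * K ^ 4 / (c ^ 6 * N ^ 2) := by
    have h := Real.pow_div_factorial_le_exp y hy0 6
    norm_num [Nat.factorial] at h
    rw [Real.exp_neg, inv_le_comm₀ (Real.exp_pos _) (by positivity), inv_div]
    refine le_trans ?_ h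
    rw [div_le_div_iff₀ (by positivity) (by norm_num)]
    nlinarith
  have hsplit : Real.exp (N * (β * x ^ p)) =
      Real.exp (N * binEnt x) * Real.exp (N * Hfun p β 0 x) := by
    rw [← Real.exp_add, Hfun]; ring_nf
  have hle : Real.exp (N * Hfun p β 0 x) ≤ Real.exp (N * Hfun p β 0 m) * Real.exp (-y) := by
    rw [← Real.exp_add, Real.exp_le_exp]
    have := mul_le_mul_of_nonneg_left hH hN0.le
    linarith
  calc _ = N.choose k * Real.exp (N * binEnt x) * Real.exp (N * Hfun p β 0 x) := by
        simp only [hsplit]; ring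
    _ ≤ 2 ^ N * (Real.exp (N * Hfun p β 0 m) * Real.exp (-y)) := by gcongr
    _ = Real.exp (-y) * M := by ring
    _ ≤ _ := mul_le_mul_of_nonneg_right hexpy hM.le

/-- Conditionally on the empirical mean lying in `A`, deviations from the maximizer of order
`N ^ (-1 / 3)` have probability `O(1 / N)`. -/
lemma exists_cwCondProb_far_le {p : ℕ} {β m K : ℝ} (h : isMaximizer p β 0 m)
    (hH : iteratedDeriv 2 (Hfun p β 0) m < 0) (hK : 0 < K) {A : Set ℝ} (hAo : IsOpen A)
    (hmA : m ∈ A) (hA : ∀ x ∈ closure A, isMaximizer p β 0 x → x = m) :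
    ∃ C : ℝ, 0 < C ∧ ∀ N : ℕ, 1 ≤ N →
      cwCondProb p N β 0 {σ | 1 < K * N * |mag σ / N - m| ^ 3} {σ | mag σ / N ∈ A} ≤ C / N := by
  obtain ⟨c, hc, hcb⟩ := exists_quadratic_bound h hH hA
  obtain ⟨κ, N₀, hκ, hlow⟩ := exists_le_cwMass h hAo hmA
  refine ⟨1440 * K ^ 4 / c ^ 6 / κ + N₀, by positivity, fun N hN => ?_⟩
  have hN0 : (0 : ℝ) < N := by positivity
  rcases lt_or_ge N N₀ with hlt | hge
  · refine (cwCondProb_le_one ..).trans ?_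
    rw [le_div_iff₀ hN0, one_mul]
    have : (N : ℝ) ≤ N₀ := by exact_mod_cast hlt.le
    have : 0 ≤ 1440 * K ^ 4 / c ^ 6 / κ := by positivity
    linarith
  · have hl := hlow N hN hge
    have hu := cwMass_far_le hc hK hcb hN
    set M := 2 ^ N * Real.exp (N * Hfun p β 0 m)
    have hM : 0 < M := by positivity
    have hset : ({σ | 1 < K * N * |mag σ / N - m| ^ 3} ∩ {σ | mag σ / N ∈ A} :
        Set (Fin N → Bool)) = {σ | mag σ / N ∈ A ∩ {x | 1 < K * N * |x - m| ^ 3}} := by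
      ext σ; exact and_comm
    rw [cwCondProb_eq, hset]
    calc _ ≤ (1440 * K ^ 4 / c ^ 6 / N * M) / (κ * M) := by gcongr
      _ = 1440 * K ^ 4 / c ^ 6 / κ / N := by field_simp
      _ ≤ _ := by gcongr; linarith [Nat.cast_nonneg (α := ℝ) N₀]

/-- **Quadratic approximation of `√N(β̂ - β)` (Lemma 4.1).** -/
theorem mple_quadratic_approximation
    (p : ℕ) (hp : 3 ≤ p) (β m : ℝ) (hβ : betaStar p < β) (hm0 : m ≠ 0)
    (hmax : isMaximizer p β 0 m)
    (hH'' : iteratedDeriv 2 (Hfun p β 0) m < 0)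
    (A : Set ℝ) (hAopen : IsOpen A) (hmA : m ∈ A)
    (hAuniq : ∀ x ∈ closure A, isMaximizer p β 0 x → x = m) :
    ∃ C : ℝ, 0 < C ∧
      ∀ N : ℕ, 1 ≤ N → ∀ t : ℝ,
        (cwCondProb p N β 0
            {σ | deriv (gMPL p) m * (Real.sqrt N * (mag σ / N - m)) +
                iteratedDeriv 2 (gMPL p) m / (2 * Real.sqrt N) *
                  (Real.sqrt N * (mag σ / N - m)) ^ 2 > t + 1 / Real.sqrt N}
            {σ | mag σ / N ∈ A} - C / N
          ≤ cwCondProb p N β 0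
              {σ | Real.sqrt N * (gMPL p (mag σ / N) - β) > t}
              {σ | mag σ / N ∈ A}) ∧
        (cwCondProb p N β 0
            {σ | Real.sqrt N * (gMPL p (mag σ / N) - β) > t}
            {σ | mag σ / N ∈ A}
          ≤ cwCondProb p N β 0
              {σ | deriv (gMPL p) m * (Real.sqrt N * (mag σ / N - m)) +
                  iteratedDeriv 2 (gMPL p) m / (2 * Real.sqrt N) *
                    (Real.sqrt N * (mag σ / N - m)) ^ 2 > t - 1 / Real.sqrt N}
              {σ | mag σ / N ∈ A} + C / N) := by
  obtain ⟨K₀, r, hK₀, hr, hT⟩ := exists_taylor_two_bound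
    (contDiffAt_gMPL p (by omega) hmax.1 hm0)
  set K := max K₀ (2 / r ^ 3)
  have hK : 0 < K := lt_max_of_lt_left hK₀
  obtain ⟨C, hC, hfar⟩ := exists_cwCondProb_far_le hmax hH'' hK hAopen hmA hAuniq
  refine ⟨C, hC, fun N hN t => ?_⟩
  have hN0 : (0 : ℝ) < N := by positivity
  have hN1 : (1 : ℝ) ≤ N := by exact_mod_cast hN
  have hs : 0 < Real.sqrt N := Real.sqrt_pos.2 hN0
  have hss : Real.sqrt N * Real.sqrt N = N := Real.mul_self_sqrt hN0.le
  have hclose : ∀ x : ℝ, ¬ 1 < K * N * |x - m| ^ 3 →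
      |Real.sqrt N * (gMPL p x - β) - (deriv (gMPL p) m * (Real.sqrt N * (x - m)) +
        iteratedDeriv 2 (gMPL p) m / (2 * Real.sqrt N) * (Real.sqrt N * (x - m)) ^ 2)|
        ≤ 1 / Real.sqrt N := by
    intro x hx
    rw [not_lt] at hx
    have hd0 : 0 ≤ |x - m| ^ 3 := by positivity
    have hxr : |x - m| < r := by
      refine lt_of_pow_lt_pow_left₀ 3 hr.le ?_
      have h1 : 2 / r ^ 3 * |x - m| ^ 3 ≤ 1 := by
        refine le_trans ?_ hx
        refine mul_le_mul_of_nonneg_right ?_ hd0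
        exact (le_max_right _ _).trans (le_mul_of_one_le_right hK.le hN1)
      rw [div_mul_eq_mul_div, div_le_one (by positivity)] at h1
      have : 0 < r ^ 3 := by positivity
      linarith
    have hTx := hT x hxr
    rw [hmax.gMPL_eq (by omega) hm0] at hTx
    have heq : Real.sqrt N * (gMPL p x - β) - (deriv (gMPL p) m * (Real.sqrt N * (x - m)) +
        iteratedDeriv 2 (gMPL p) m / (2 * Real.sqrt N) * (Real.sqrt N * (x - m)) ^ 2) =
        Real.sqrt N * (gMPL p x - (β + deriv (gMPL p) m * (x - m) +
          iteratedDeriv 2 (gMPL p) m / 2 * (x - m) ^ 2)) := by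
      field_simp
      ring
    rw [heq, abs_mul, abs_of_pos hs, le_div_iff₀ hs]
    calc _ = (N : ℝ) * |gMPL p x - (β + deriv (gMPL p) m * (x - m) +
          iteratedDeriv 2 (gMPL p) m / 2 * (x - m) ^ 2)| := by
          rw [mul_right_comm, hss]
      _ ≤ N * (K * |x - m| ^ 3) :=
          mul_le_mul_of_nonneg_left
            (hTx.trans (mul_le_mul_of_nonneg_right (le_max_left _ _) hd0)) hN0.le
      _ ≤ 1 := by linarith
  constructor
  · rw [sub_le_iff_le_add]
    refine (cwCondProb_le_add p N β fun σ hσ => ?_).trans (add_le_add le_rfl (hfar N hN))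
    by_cases hf : 1 < K * N * |mag σ / N - m| ^ 3
    · exact Or.inr hf
    · refine Or.inl ?_
      have h1 := (abs_le.1 (hclose _ hf)).1
      have h2 := hσ.1
      simp only [Set.mem_ofPred_eq] at h2 ⊢
      linarith
  · refine (cwCondProb_le_add p N β fun σ hσ => ?_).trans (add_le_add le_rfl (hfar N hN))
    by_cases hf : 1 < K * N * |mag σ / N - m| ^ 3
    · exact Or.inr hf
    · refine Or.inl ?_
      have h1 := (abs_le.1 (hclose _ hf)).2
      have h2 := hσ.1
      simp only [Set.mem_ofPred_eq] at h2 ⊢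
      linarith
end
end
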